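/- arXiv:1805.11960 — 7 statements merged into one kernel-verified Lean document; each statement's English description precedes it below -/
import Mathlib

section
/- For a Tychonoff space X with the Velichko property (X ⊨ V), the following are equivalent: (1) C_p(X) satisfies F_fin(𝒮, 𝒮); (2) X satisfies U_fin(Γ_F, Γ); (3) C_p(X) satisfies F_fin(Γ_0, Γ_0); (4) C_p(X) satisfies F_fin(𝒮, Γ_0). -/
open Set Filter Topology

universe u

/-- A zero-set: the preimage of `{0}` under some continuous real-valued function. -/
def IsZeroSet {X : Type u} [TopologicalSpace X] (Z : Set X) : Prop :=
  ∃ f : X → ℝ, Continuous f ∧ Z = f ⁻¹' {0}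

/-- A cozero-set: the complement of a zero-set. -/
def IsCozeroSet {X : Type u} [TopologicalSpace X] (U : Set X) : Prop :=
  IsZeroSet Uᶜ

/-- A γ-cover (no openness requirement): an infinite nontrivial cover such that every
point belongs to all but finitely many members. -/
def IsGammaCoverSets {X : Type u} (𝒰 : Set (Set X)) : Prop :=
  (univ : Set X) ∉ 𝒰 ∧ 𝒰.Infinite ∧ ⋃₀ 𝒰 = (univ : Set X) ∧
    ∀ x : X, {U ∈ 𝒰 | x ∉ U}.Finite

/-- An open γ-cover. -/
def IsOpenGammaCover {X : Type u} [TopologicalSpace X] (𝒰 : Set (Set X)) : Prop :=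
  (∀ U ∈ 𝒰, IsOpen U) ∧ IsGammaCoverSets 𝒰

/-- A γ_F-shrinkable γ-cover: a γ-cover of cozero-sets admitting a shrinking by zero-sets
which is again a γ-cover. -/
def IsGammaFCover {X : Type u} [TopologicalSpace X] (𝒰 : Set (Set X)) : Prop :=
  IsOpenGammaCover 𝒰 ∧ (∀ U ∈ 𝒰, IsCozeroSet U) ∧
    ∃ F : Set X → Set X, (∀ U ∈ 𝒰, IsZeroSet (F U) ∧ F U ⊆ U) ∧
      IsGammaCoverSets (F '' 𝒰)

/-- An ω-cover: a nontrivial open cover such that every finite subset of the space is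
contained in some member. -/
def IsOmegaCover {X : Type u} [TopologicalSpace X] (𝒰 : Set (Set X)) : Prop :=
  (∀ U ∈ 𝒰, IsOpen U) ∧ (univ : Set X) ∉ 𝒰 ∧ ⋃₀ 𝒰 = (univ : Set X) ∧
    ∀ K : Set X, K.Finite → ∃ U ∈ 𝒰, K ⊆ U

/-- The family contains a finite subcover. -/
def HasFinSubcover {X : Type u} (𝒰 : Set (Set X)) : Prop :=
  ∃ 𝓕 ⊆ 𝒰, 𝓕.Finite ∧ ⋃₀ 𝓕 = (univ : Set X)

/-- `U_fin(Γ_F, Ω)`. -/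
def UfinGammaFOmega (X : Type u) [TopologicalSpace X] : Prop :=
  ∀ 𝒰 : ℕ → Set (Set X), (∀ n, IsGammaFCover (𝒰 n)) →
    (∀ n, ¬ HasFinSubcover (𝒰 n)) →
    ∃ 𝓕 : ℕ → Set (Set X), (∀ n, 𝓕 n ⊆ 𝒰 n ∧ (𝓕 n).Finite) ∧
      IsOmegaCover (Set.range fun n => ⋃₀ 𝓕 n)

/-- `U_fin(Γ_F, Γ)`. -/
def UfinGammaFGamma (X : Type u) [TopologicalSpace X] : Prop :=
  ∀ 𝒰 : ℕ → Set (Set X), (∀ n, IsGammaFCover (𝒰 n)) →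
    (∀ n, ¬ HasFinSubcover (𝒰 n)) →
    ∃ 𝓕 : ℕ → Set (Set X), (∀ n, 𝓕 n ⊆ 𝒰 n ∧ (𝓕 n).Finite) ∧
      IsOpenGammaCover (Set.range fun n => ⋃₀ 𝓕 n)

/-- `U_fin(𝒪, Ω)`. -/
def UfinOOmega (X : Type u) [TopologicalSpace X] : Prop :=
  ∀ 𝒰 : ℕ → Set (Set X),
    (∀ n, (∀ U ∈ 𝒰 n, IsOpen U) ∧ ⋃₀ 𝒰 n = (univ : Set X)) →
    (∀ n, ¬ HasFinSubcover (𝒰 n)) →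
    ∃ 𝓕 : ℕ → Set (Set X), (∀ n, 𝓕 n ⊆ 𝒰 n ∧ (𝓕 n).Finite) ∧
      IsOmegaCover (Set.range fun n => ⋃₀ 𝓕 n)

/-- The Hurewicz property `U_fin(𝒪, Γ)`. -/
def HurewiczProperty (X : Type u) [TopologicalSpace X] : Prop :=
  ∀ 𝒰 : ℕ → Set (Set X),
    (∀ n, (∀ U ∈ 𝒰 n, IsOpen U) ∧ ⋃₀ 𝒰 n = (univ : Set X)) →
    ∃ 𝓕 : ℕ → Set (Set X), (∀ n, 𝓕 n ⊆ 𝒰 n ∧ (𝓕 n).Finite) ∧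
      ∀ x : X, {n : ℕ | x ∉ ⋃₀ 𝓕 n}.Finite

/- Function space notions.  `C_p(X)` is the set of continuous functions `X → ℝ` with
the topology of pointwise convergence, i.e. the topology inherited from the product
topology on `X → ℝ` (the default `Pi` topology instance). -/

/-- A sequentially dense subset of `C_p(X)`: every continuous function is the pointwise
limit of a sequence from `D`. -/
def SeqDenseCp {X : Type u} [TopologicalSpace X] (D : Set (X → ℝ)) : Prop :=
  (∀ f ∈ D, Continuous f) ∧ ∀ f : X → ℝ, Continuous f →
    ∃ g : ℕ → X → ℝ, (∀ n, g n ∈ D) ∧ Tendsto g atTop (𝓝 f)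

/-- A dense subset of `C_p(X)`: every neighborhood (in the topology of pointwise
convergence) of every continuous function meets `D`. -/
def DenseCp {X : Type u} [TopologicalSpace X] (D : Set (X → ℝ)) : Prop :=
  (∀ f ∈ D, Continuous f) ∧ ∀ f : X → ℝ, Continuous f →
    ∀ U ∈ 𝓝 f, (U ∩ D).Nonempty

/-- `C_p(X)` is separable. -/
def CpSeparable (X : Type u) [TopologicalSpace X] : Prop :=
  ∃ D : Set (X → ℝ), D.Countable ∧ DenseCp D

/-- `C_p(X)` is sequentially separable. -/
def CpSeqSeparable (X : Type u) [TopologicalSpace X] : Prop :=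
  ∃ D : Set (X → ℝ), D.Countable ∧ SeqDenseCp D

/-- `A ∈ Γ_0`: a countable set of continuous functions, not containing `0`, infinite,
converging to `0` (every neighborhood of `0` in the topology of pointwise convergence
contains all but finitely many elements of `A`). -/
def GammaZero {X : Type u} [TopologicalSpace X] (A : Set (X → ℝ)) : Prop :=
  A.Countable ∧ (∀ f ∈ A, Continuous f) ∧ (0 : X → ℝ) ∉ A ∧ A.Infinite ∧
    ∀ U ∈ 𝓝 (0 : X → ℝ), (A \ U).Finite

/-- `C_p(X)` satisfies `F_fin(𝒮, 𝒟)`. -/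
def FfinSD (X : Type u) [TopologicalSpace X] : Prop :=
  ∀ S : ℕ → Set (X → ℝ), (∀ n, SeqDenseCp (S n)) →
    ∃ F : ℕ → Set (X → ℝ), (∀ n, F n ⊆ S n ∧ (F n).Finite) ∧
      ∀ f : X → ℝ, Continuous f → ∀ ε : ℝ, 0 < ε → ∀ K : Set X, K.Finite →
        ∃ n : ℕ, ∀ x ∈ K, ∃ h ∈ F n, |f x - h x| < ε

/-- `C_p(X)` satisfies `F_fin(Γ_0, Ω_0)`. -/
def FfinGammaOmega (X : Type u) [TopologicalSpace X] : Prop :=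
  ∀ S : ℕ → Set (X → ℝ), (∀ n, GammaZero (S n)) →
    ∃ F : ℕ → Set (X → ℝ), (∀ n, F n ⊆ S n ∧ (F n).Finite) ∧
      ∀ ε : ℝ, 0 < ε → ∀ K : Set X, K.Finite →
        ∃ n : ℕ, ∀ x ∈ K, ∃ h ∈ F n, |h x| < ε

/-- `C_p(X)` satisfies `F_fin(𝒮, Ω_0)`. -/
def FfinSOmega (X : Type u) [TopologicalSpace X] : Prop :=
  ∀ S : ℕ → Set (X → ℝ), (∀ n, SeqDenseCp (S n)) →
    ∃ F : ℕ → Set (X → ℝ), (∀ n, F n ⊆ S n ∧ (F n).Finite) ∧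
      ∀ ε : ℝ, 0 < ε → ∀ K : Set X, K.Finite →
        ∃ n : ℕ, ∀ x ∈ K, ∃ h ∈ F n, |h x| < ε

/-- `C_p(X)` satisfies `F_fin(𝒮, 𝒮)`. -/
def FfinSS (X : Type u) [TopologicalSpace X] : Prop :=
  ∀ S : ℕ → Set (X → ℝ), (∀ n, SeqDenseCp (S n)) →
    ∃ F : ℕ → Set (X → ℝ), (∀ n, F n ⊆ S n ∧ (F n).Finite) ∧
      ∀ f : X → ℝ, Continuous f → ∀ ε : ℝ, 0 < ε → ∀ K : Set X, K.Finite →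
        ∃ n' : ℕ, ∀ n : ℕ, n' < n → ∀ x ∈ K, ∃ h ∈ F n, |f x - h x| < ε

/-- `C_p(X)` satisfies `F_fin(Γ_0, Γ_0)`. -/
def FfinGammaGamma (X : Type u) [TopologicalSpace X] : Prop :=
  ∀ S : ℕ → Set (X → ℝ), (∀ n, GammaZero (S n)) →
    ∃ F : ℕ → Set (X → ℝ), (∀ n, F n ⊆ S n ∧ (F n).Finite) ∧
      ∀ ε : ℝ, 0 < ε → ∀ K : Set X, K.Finite →
        ∃ n' : ℕ, ∀ n : ℕ, n' < n → ∀ x ∈ K, ∃ h ∈ F n, |h x| < ε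

/-- `C_p(X)` satisfies `F_fin(𝒮, Γ_0)`. -/
def FfinSGamma (X : Type u) [TopologicalSpace X] : Prop :=
  ∀ S : ℕ → Set (X → ℝ), (∀ n, SeqDenseCp (S n)) →
    ∃ F : ℕ → Set (X → ℝ), (∀ n, F n ⊆ S n ∧ (F n).Finite) ∧
      ∀ ε : ℝ, 0 < ε → ∀ K : Set X, K.Finite →
        ∃ n' : ℕ, ∀ n : ℕ, n' < n → ∀ x ∈ K, ∃ h ∈ F n, |h x| < ε

/-- `iw(X) = ℵ₀`: there is a continuous bijection from `X` onto a second-countable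
Tychonoff space. -/
def IWCountable (X : Type u) [TopologicalSpace X] : Prop :=
  ∃ (Y : Type u) (tY : TopologicalSpace Y),
    @SecondCountableTopology Y tY ∧ @CompletelyRegularSpace Y tY ∧ @T2Space Y tY ∧
    ∃ f : X → Y, @Continuous X Y _ tY f ∧ Function.Bijective f

/-- The Velichko property `X ⊨ V`: there is a continuous bijection onto a separable
metrizable space sending every cozero-set to an `F_σ`-set. -/
def VelichkoProperty (X : Type u) [TopologicalSpace X] : Prop :=
  ∃ (Y : Type u) (tY : TopologicalSpace Y),
    @TopologicalSpace.MetrizableSpace Y tY ∧ @TopologicalSpace.SeparableSpace Y tY ∧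
    ∃ f : X → Y, @Continuous X Y _ tY f ∧ Function.Bijective f ∧
      ∀ U : Set X, IsCozeroSet U →
        ∃ Z : ℕ → Set Y, (∀ n, @IsClosed Y tY (Z n)) ∧ f '' U = ⋃ n, Z n

section SelectionPrinciples

variable {X : Type u}

/-- A family of nonnegative continuous functions `φ n m`, null as `m → ∞`, admits bounds `g n` such
that every point eventually finds `m ≤ g n` with `φ n m < 1`. -/
def HasDiagonalBounds (X : Type u) [TopologicalSpace X] : Prop :=
  ∀ φ : ℕ → ℕ → X → ℝ, (∀ n m, Continuous (φ n m)) → (∀ n m x, 0 ≤ φ n m x) →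
    (∀ n x, Tendsto (fun m => φ n m x) atTop (𝓝 0)) →
    ∃ g : ℕ → ℕ, ∀ x, ∀ᶠ n in atTop, ∃ m ≤ g n, φ n m x < 1

theorem exists_le_injective_comp {α : Type*} {W : ℕ → α} (hW : (range W).Infinite) :
    ∃ N : ℕ → ℕ, (∀ n, n ≤ N n) ∧ Function.Injective (W ∘ N) := by
  choose N hN using fun n => (hW.natEmbedding _ n).2
  have hinj : Function.Injective (W ∘ N) := by
    intro a b hab
    refine (hW.natEmbedding _).injective (Subtype.ext ?_)
    rw [← hN a, ← hN b]
    exact hab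
  obtain ⟨s, hs, hNs⟩ := strictMono_subseq_of_tendsto_atTop hinj.of_comp.nat_tendsto_atTop
  exact ⟨N ∘ s, hNs.id_le, hinj.comp hs.injective⟩

theorem exists_index_bound_of_finite {α : Type*} {ψ : ℕ → α} {F : Set α} (hF : F.Finite)
    (h : F ⊆ range ψ) : ∃ M, ∀ a ∈ F, ∃ m ≤ M, a = ψ m := by
  choose! r hr using fun a (ha : a ∈ F) => h ha
  obtain ⟨M, hM⟩ := (hF.image r).bddAbove
  exact ⟨M, fun a ha => ⟨r a, hM ⟨a, ha, rfl⟩, (hr a ha).symm⟩⟩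

theorem eventually_lt_of_tendsto_zero_of_finite {ψ : ℕ → X → ℝ}
    (h : ∀ x, Tendsto (fun m => ψ m x) atTop (𝓝 0)) {c : ℝ} (hc : 0 < c) (x : X) :
    {m | ¬ ψ m x < c}.Finite := by
  have := (h x).eventually (gt_mem_nhds hc)
  rw [← Nat.cofinite_eq_atTop] at this
  exact this

variable [TopologicalSpace X]

theorem isCozeroSet_lt {f : X → ℝ} (hf : Continuous f) (c : ℝ) : IsCozeroSet {x | f x < c} := by
  refine ⟨fun x => max (c - f x) 0, by fun_prop, ?_⟩
  ext x
  simp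

theorem isZeroSet_le {f : X → ℝ} (hf : Continuous f) (c : ℝ) : IsZeroSet {x | f x ≤ c} := by
  refine ⟨fun x => max (f x - c) 0, by fun_prop, ?_⟩
  ext x
  simp

theorem isGammaFCover_of_tendsto_zero {ψ : ℕ → X → ℝ} (hc : ∀ m, Continuous (ψ m))
    (h0 : ∀ x, Tendsto (fun m => ψ m x) atTop (𝓝 0))
    (hbad : ¬ ∃ M, ∀ x, ∃ m ≤ M, ψ m x < 1) :
    IsGammaFCover (range fun m => {x | ψ m x < 1}) ∧
      ¬ HasFinSubcover (range fun m => {x | ψ m x < 1}) := by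
  set U : ℕ → Set X := fun m => {x | ψ m x < 1} with hU
  have hfin : ¬ HasFinSubcover (range U) := by
    rintro ⟨𝓕, hsub, hf, hcov⟩
    obtain ⟨M, hM⟩ := exists_index_bound_of_finite hf hsub
    refine hbad ⟨M, fun x => ?_⟩
    obtain ⟨V, hV, hxV⟩ := mem_sUnion.1 (hcov.symm ▸ mem_univ x)
    obtain ⟨m, hm, rfl⟩ := hM V hV
    exact ⟨m, hm, hxV⟩
  have hpt : ∀ {c : ℝ}, 0 < c → ∀ x, {m | ¬ ψ m x < c}.Finite := fun hc x =>
    eventually_lt_of_tendsto_zero_of_finite h0 hc x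
  have huniv : univ ∉ range U := fun h =>
    hfin ⟨{univ}, singleton_subset_iff.2 h, finite_singleton _, sUnion_singleton _⟩
  have hexists : ∀ x, ∃ m, ψ m x < 1 / 2 := fun x =>
    ((h0 x).eventually (gt_mem_nhds (by norm_num))).exists
  have hcover : ⋃₀ range U = univ := by
    refine eq_univ_of_forall fun x => ?_
    obtain ⟨m, hm⟩ := hexists x
    exact mem_sUnion.2 ⟨U m, ⟨m, rfl⟩, by simp only [hU, mem_ofPred_eq]; linarith⟩
  have hinf : (range U).Infinite := fun h => hfin ⟨_, Subset.rfl, h, hcover⟩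
  choose! r hr using fun V (hV : V ∈ range U) => hV
  let F : Set X → Set X := fun V => {x | ψ (r V) x ≤ 1 / 2}
  have hFsub : ∀ V ∈ range U, F V ⊆ V := by
    intro V hV x hx
    rw [← hr V hV]
    have : ψ (r V) x ≤ 1 / 2 := hx
    simp only [hU, mem_ofPred_eq]
    linarith
  have hFfin : ∀ x, {V ∈ range U | x ∉ F V}.Finite := by
    intro x
    refine ((hpt one_half_pos x).image U).subset ?_
    rintro V ⟨hV, hx⟩
    exact ⟨r V, fun h => hx h.le, hr V hV⟩
  have hFcover : ⋃₀ (F '' range U) = univ := by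
    refine eq_univ_of_forall fun x => ?_
    obtain ⟨V, hV, hxV⟩ := (hinf.sdiff (hFfin x)).nonempty
    exact mem_sUnion.2 ⟨F V, ⟨V, hV, rfl⟩, by_contra fun h => hxV ⟨hV, h⟩⟩
  refine ⟨⟨⟨?_, huniv, hinf, hcover, ?_⟩, ?_, F, ?_, ?_, ?_, hFcover, ?_⟩, hfin⟩
  · rintro _ ⟨m, rfl⟩
    exact isOpen_lt (hc m) continuous_const
  · intro x
    refine (hFfin x).subset ?_
    rintro V ⟨hV, hx⟩
    exact ⟨hV, fun h => hx (hFsub V hV h)⟩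
  · rintro _ ⟨m, rfl⟩
    exact isCozeroSet_lt (hc m) 1
  · exact fun V hV => ⟨isZeroSet_le (hc _) _, hFsub V hV⟩
  · rintro ⟨V, hV, hVu⟩
    exact huniv (univ_subset_iff.1 (hVu ▸ hFsub V hV) ▸ hV)
  · intro h
    choose! p hp using fun W (hW : W ∈ F '' range U) => hW
    refine hfin ⟨p '' (F '' range U), image_subset_iff.2 fun W hW => (hp W hW).1, h.image p,
      eq_univ_of_forall fun x => ?_⟩
    obtain ⟨W, hW, hxW⟩ := mem_sUnion.1 (hFcover.symm ▸ mem_univ x)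
    exact mem_sUnion.2
      ⟨p W, mem_image_of_mem p hW, hFsub _ (hp W hW).1 ((hp W hW).2.symm ▸ hxW)⟩
  · intro x
    refine ((hFfin x).image F).subset ?_
    rintro _ ⟨⟨V, hV, rfl⟩, hx⟩
    exact ⟨V, ⟨hV, hx⟩, rfl⟩

theorem UfinGammaFGamma.hasDiagonalBounds (h : UfinGammaFGamma X) : HasDiagonalBounds X := by
  classical
  intro φ hφc hφ0 hφt
  let good : ℕ → Prop := fun n => ∃ M, ∀ x, ∃ m ≤ M, φ n m x < 1
  by_cases hall : ∀ n, good n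
  · choose g hg using hall
    exact ⟨g, fun x => Eventually.of_forall fun n => hg n x⟩
  push Not at hall
  obtain ⟨n₀, hn₀⟩ := hall
  let ψ : ℕ → ℕ → X → ℝ := fun N m x =>
    ∑ n ∈ (Finset.range (N + n₀ + 1)).filter (fun n => ¬ good n), φ n m x
  have hle : ∀ {n N}, ¬ good n → n ≤ N + n₀ → ∀ m x, φ n m x ≤ ψ N m x := by
    intro n N hn hnN m x
    refine Finset.single_le_sum (f := fun n => φ n m x) (fun i _ => hφ0 i m x) ?_
    simp only [Finset.mem_filter, Finset.mem_range]
    exact ⟨by omega, hn⟩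
  have hψ : ∀ N, IsGammaFCover (range fun m => {x | ψ N m x < 1}) ∧
      ¬ HasFinSubcover (range fun m => {x | ψ N m x < 1}) := by
    intro N
    refine isGammaFCover_of_tendsto_zero (fun m => continuous_finsetSum _ fun i _ => hφc i m)
      (fun x => ?_) ?_
    · simpa using tendsto_finsetSum
        ((Finset.range (N + n₀ + 1)).filter (fun n => ¬ good n)) fun i _ => hφt i x
    · rintro ⟨M, hM⟩
      refine hn₀ ⟨M, fun x => ?_⟩
      obtain ⟨m, hm, hlt⟩ := hM x
      exact ⟨m, hm, (hle hn₀ (by omega) m x).trans_lt hlt⟩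
  obtain ⟨𝓕, h𝓕, hγ⟩ := h _ (fun N => (hψ N).1) (fun N => (hψ N).2)
  choose G hG using fun N => exists_index_bound_of_finite (h𝓕 N).2 (h𝓕 N).1
  obtain ⟨N, hN, hinj⟩ := exists_le_injective_comp hγ.2.2.1
  have hbad : ∀ x, ∀ᶠ n in atTop, ∀ _ : ¬ good n, ∃ m ≤ G (N n), φ n m x < 1 := by
    intro x
    have hfin := (hγ.2.2.2.2 x).preimage (f := (fun n => ⋃₀ 𝓕 n) ∘ N) hinj.injOn
    have hev : ∀ᶠ n in atTop, x ∈ ⋃₀ 𝓕 (N n) := by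
      rw [← Nat.cofinite_eq_atTop]
      refine hfin.subset fun n hn => ⟨⟨N n, rfl⟩, hn⟩
    filter_upwards [hev] with n hn hbn
    obtain ⟨V, hV, hxV⟩ := mem_sUnion.1 hn
    obtain ⟨m, hm, rfl⟩ := hG _ V hV
    exact ⟨m, hm, (hle hbn ((hN n).trans (Nat.le_add_right _ _)) m x).trans_lt hxV⟩
  choose! M hM using fun n (hn : good n) => hn
  refine ⟨fun n => if good n then M n else G (N n), fun x => ?_⟩
  filter_upwards [hbad x] with n hn
  by_cases hg : good n
  · simpa [hg] using hM n hg x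
  · simpa [hg] using hn hg

theorem exists_continuous_separating {A B : Set X} (hA : IsZeroSet A) (hB : IsCozeroSet B)
    (hAB : A ⊆ B) :
    ∃ f : X → ℝ, Continuous f ∧ (∀ x, 0 ≤ f x) ∧ (∀ x ∈ A, f x = 0) ∧ ∀ x, f x < 1 → x ∈ B := by
  obtain ⟨a, ha, rfl⟩ := hA
  obtain ⟨b, hb, hBb⟩ := hB
  have hmem : ∀ x, x ∉ B ↔ b x = 0 := fun x => by
    rw [← mem_compl_iff, hBb]; rfl
  have hpos : ∀ x, 0 < |a x| + |b x| := by
    intro x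
    by_cases hx : a x = 0
    · have : b x ≠ 0 := fun h => (hmem x).2 h (hAB hx)
      positivity
    · positivity
  refine ⟨fun x => |a x| / (|a x| + |b x|), ?_, fun x => by positivity, ?_, ?_⟩
  · exact ha.abs.div (ha.abs.add hb.abs) fun x => (hpos x).ne'
  · intro x hx
    have : a x = 0 := hx
    simp [this]
  · intro x hx
    by_contra hxB
    rw [hmem] at hxB
    have := hpos x
    simp only [hxB, abs_zero, add_zero] at hx this
    rw [div_self this.ne'] at hx
    exact lt_irrefl _ hx

theorem HasDiagonalBounds.ufinGammaFGamma (h : HasDiagonalBounds X) : UfinGammaFGamma X := by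
  intro 𝒰 h𝒰 hfin
  have key : ∀ n, ∃ U : ℕ → Set X, ∃ φ : ℕ → X → ℝ, (∀ m, U m ∈ 𝒰 n) ∧
      (∀ m, Continuous (φ m)) ∧ (∀ m x, 0 ≤ φ m x) ∧
      (∀ x, Tendsto (fun m => φ m x) atTop (𝓝 0)) ∧ ∀ m x, φ m x < 1 → x ∈ U m := by
    intro n
    obtain ⟨-, hcoz, F, hF, -, hFinf, -, hFpt⟩ := h𝒰 n
    let e := hFinf.natEmbedding
    choose U hU hFU using fun m => (e m).2
    choose φ hφc hφ0 hφz hφ1 using fun m =>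
      exists_continuous_separating (hF _ (hU m)).1 (hcoz _ (hU m)) (hF _ (hU m)).2
    refine ⟨U, φ, hU, hφc, hφ0, fun x => ?_, hφ1⟩
    have hev : ∀ᶠ m in atTop, x ∈ F (U m) := by
      rw [← Nat.cofinite_eq_atTop]
      refine ((hFpt x).preimage (f := fun m => (e m : Set X))
        (Subtype.val_injective.comp e.injective).injOn).subset fun m hm => ?_
      exact ⟨(e m).2, fun hx => hm ((hFU m).symm ▸ hx : x ∈ F (U m))⟩
    refine tendsto_const_nhds.congr' ?_
    filter_upwards [hev] with m hm using (hφz m x hm).symm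
  choose U φ hU hφc hφ0 hφt hφ1 using key
  obtain ⟨g, hg⟩ := h φ hφc hφ0 hφt
  let 𝓕 : ℕ → Set (Set X) := fun n => U n '' Iic (g n)
  have hsub : ∀ n, 𝓕 n ⊆ 𝒰 n ∧ (𝓕 n).Finite := fun n =>
    ⟨image_subset_iff.2 fun m _ => hU n m, (finite_Iic _).image _⟩
  have hev : ∀ x, ∀ᶠ n in atTop, x ∈ ⋃₀ 𝓕 n := by
    intro x
    filter_upwards [hg x] with n ⟨m, hm, hlt⟩
    exact mem_sUnion.2 ⟨U n m, ⟨m, hm, rfl⟩, hφ1 n m x hlt⟩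
  have hne : ∀ n, ⋃₀ 𝓕 n ≠ univ := fun n hn => hfin n ⟨𝓕 n, (hsub n).1, (hsub n).2, hn⟩
  refine ⟨𝓕, hsub, ?_, ?_, ?_, ?_, ?_⟩
  · rintro _ ⟨n, rfl⟩
    exact isOpen_sUnion fun V hV => (h𝒰 n).1.1 V ((hsub n).1 hV)
  · rintro ⟨n, hn⟩
    exact hne n hn
  · intro hr
    choose x hx using fun n => (ne_univ_iff_exists_notMem _).1 (hne n)
    have hr' : ∀ W ∈ range fun n => ⋃₀ 𝓕 n, ∃ y, y ∉ W := by
      rintro _ ⟨n, rfl⟩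
      exact ⟨x n, hx n⟩
    have : Nonempty X := ⟨x 0⟩
    choose! y hy using hr'
    obtain ⟨n, hn⟩ := (hr.eventually_all.2 fun W _ => hev (y W)).exists
    exact hy _ ⟨n, rfl⟩ (hn _ ⟨n, rfl⟩)
  · refine eq_univ_of_forall fun x => ?_
    obtain ⟨n, hn⟩ := (hev x).exists
    exact mem_sUnion.2 ⟨_, ⟨n, rfl⟩, hn⟩
  · intro x
    have hx := hev x
    rw [← Nat.cofinite_eq_atTop] at hx
    refine (Set.Finite.image (fun n => ⋃₀ 𝓕 n) hx).subset ?_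
    rintro _ ⟨⟨n, rfl⟩, hn⟩
    exact ⟨n, hn, rfl⟩

theorem HasDiagonalBounds.ffinGammaGamma (h : HasDiagonalBounds X) : FfinGammaGamma X := by
  intro S hS
  have key : ∀ n, ∃ f : ℕ → X → ℝ, (∀ m, f m ∈ S n) ∧
      ∀ x, Tendsto (fun m => f m x) atTop (𝓝 0) := by
    intro n
    obtain ⟨-, -, -, hinf, hnhds⟩ := hS n
    let e := hinf.natEmbedding
    have ht : Tendsto (fun m => (e m : X → ℝ)) atTop (𝓝 0) := by
      rw [← Nat.cofinite_eq_atTop]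
      intro U hU
      exact ((hnhds U hU).preimage (f := fun m => (e m : X → ℝ))
        (Subtype.val_injective.comp e.injective).injOn).subset fun m hm => ⟨(e m).2, hm⟩
    exact ⟨fun m => e m, fun m => (e m).2, tendsto_pi_nhds.1 ht⟩
  choose f hf hft using key
  have hfc : ∀ n m, Continuous (f n m) := fun n m => (hS n).2.1 _ (hf n m)
  obtain ⟨g, hg⟩ := h (fun n m x => (n + 1) * |f n m x|)
    (fun n m => continuous_const.mul (hfc n m).abs) (fun n m x => by positivity)
    (fun n x => by simpa using ((hft n x).abs.const_mul ((n : ℝ) + 1)))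
  refine ⟨fun n => f n '' Iic (g n), fun n =>
    ⟨image_subset_iff.2 fun m _ => hf n m, (finite_Iic _).image _⟩, fun ε hε K hK => ?_⟩
  have hε' : ∀ᶠ n : ℕ in atTop, 1 / ((n : ℝ) + 1) < ε :=
    tendsto_one_div_add_atTop_nhds_zero_nat.eventually (gt_mem_nhds hε)
  obtain ⟨N, hN⟩ := eventually_atTop.1 (hε'.and (hK.eventually_all.2 fun x _ => hg x))
  refine ⟨N, fun n hn x hx => ?_⟩
  obtain ⟨hn1, hn2⟩ := hN n hn.le
  obtain ⟨m, hm, hlt⟩ := hn2 x hx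
  refine ⟨f n m, ⟨m, hm, rfl⟩, lt_of_le_of_lt ?_ hn1⟩
  rw [le_div_iff₀ (by positivity)]
  linarith

theorem gammaZero_range {ψ : ℕ → X → ℝ} (hc : ∀ m, Continuous (ψ m)) (hne : ∀ m, ψ m ≠ 0)
    (ht : Tendsto ψ atTop (𝓝 0)) : GammaZero (range ψ) := by
  have h0 : (0 : X → ℝ) ∉ range ψ := by
    rintro ⟨m, hm⟩
    exact hne m hm
  refine ⟨countable_range _, ?_, h0, fun hfin => ?_, fun U hU => ?_⟩
  · rintro _ ⟨m, rfl⟩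
    exact hc m
  · exact h0 (hfin.isClosed.mem_of_tendsto ht (Eventually.of_forall fun m => ⟨m, rfl⟩))
  · have hev := ht.eventually hU
    rw [← Nat.cofinite_eq_atTop] at hev
    refine (Set.Finite.image ψ hev).subset ?_
    rintro _ ⟨⟨m, rfl⟩, hm⟩
    exact ⟨m, hm, rfl⟩

theorem FfinGammaGamma.hasDiagonalBounds (h : FfinGammaGamma X) : HasDiagonalBounds X := by
  intro φ hφc hφ0 hφt
  rcases isEmpty_or_nonempty X with hX | ⟨⟨x₀⟩⟩
  · exact ⟨0, fun x => hX.elim x⟩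
  let ψ : ℕ → ℕ → X → ℝ := fun n m x => φ n m x + 1 / ((m : ℝ) + 1)
  have hpos : ∀ m : ℕ, 0 < 1 / ((m : ℝ) + 1) := fun m => by positivity
  have hψ : ∀ n, GammaZero (range (ψ n)) := by
    refine fun n => gammaZero_range (fun m => (hφc n m).add continuous_const) (fun m hm => ?_) ?_
    · have := congrFun hm x₀
      have h1 := hφ0 n m x₀
      have h2 := hpos m
      simp only [ψ, Pi.zero_apply] at this
      linarith
    · refine tendsto_pi_nhds.2 fun x => ?_
      simpa [ψ] using (hφt n x).add tendsto_one_div_add_atTop_nhds_zero_nat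
  obtain ⟨F, hF, hFK⟩ := h _ hψ
  choose g hg using fun n => exists_index_bound_of_finite (hF n).2 (hF n).1
  refine ⟨g, fun x => ?_⟩
  obtain ⟨N, hN⟩ := hFK 1 one_pos {x} (finite_singleton x)
  filter_upwards [eventually_gt_atTop N] with n hn
  obtain ⟨f, hf, hlt⟩ := hN n hn x rfl
  obtain ⟨m, hm, rfl⟩ := hg n f hf
  refine ⟨m, hm, lt_of_le_of_lt ?_ ((le_abs_self _).trans_lt hlt)⟩
  exact le_add_of_nonneg_right (hpos m).le

theorem FfinSS.ffinSGamma (h : FfinSS X) : FfinSGamma X := by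
  intro S hS
  obtain ⟨F, hF, hFK⟩ := h S hS
  refine ⟨F, hF, fun ε hε K hK => ?_⟩
  simpa using hFK 0 continuous_const ε hε K hK

theorem HasDiagonalBounds.ffinSS (h : HasDiagonalBounds X) {d : ℕ → X → ℝ}
    (hdc : ∀ i, Continuous (d i))
    (hd : ∀ f : X → ℝ, Continuous f → ∀ ε > 0, ∀ K : Set X, K.Finite →
      ∃ i, ∀ x ∈ K, |f x - d i x| < ε) : FfinSS X := by
  intro S hS
  choose s hsS hst using fun n i => (hS n).2 (d i) (hdc i)
  have hsc : ∀ n i m, Continuous (s n i m) := fun n i m => (hS n).1 _ (hsS n i m)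
  obtain ⟨g, hg⟩ := h
    (fun n m x => (n + 1) * ∑ i ∈ Finset.range (n + 1), |s n i m x - d i x|)
    (fun n m => continuous_const.mul
      (continuous_finsetSum _ fun i _ => ((hsc n i m).sub (hdc i)).abs))
    (fun n m x => by positivity)
    (fun n x => by
      have hi : ∀ i ∈ Finset.range (n + 1),
          Tendsto (fun m => |s n i m x - d i x|) atTop (𝓝 0) := fun i _ => by
        simpa using ((tendsto_pi_nhds.1 (hst n i) x).sub_const (d i x)).abs
      simpa using (tendsto_finsetSum _ hi).const_mul ((n : ℝ) + 1))
  refine ⟨fun n => image2 (s n) (Iic n) (Iic (g n)), fun n =>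
    ⟨image2_subset_iff.2 fun i _ m _ => hsS n i m, (finite_Iic _).image2 _ (finite_Iic _)⟩,
    fun f hf ε hε K hK => ?_⟩
  obtain ⟨i, hi⟩ := hd f hf (ε / 2) (half_pos hε) K hK
  have hε' : ∀ᶠ n : ℕ in atTop, 1 / ((n : ℝ) + 1) < ε / 2 :=
    tendsto_one_div_add_atTop_nhds_zero_nat.eventually (gt_mem_nhds (half_pos hε))
  obtain ⟨N, hN⟩ := eventually_atTop.1
    ((hε'.and (eventually_ge_atTop i)).and (hK.eventually_all.2 fun x _ => hg x))
  refine ⟨N, fun n hn x hx => ?_⟩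
  obtain ⟨⟨hn1, hin⟩, hn2⟩ := hN n hn.le
  obtain ⟨m, hm, hlt⟩ := hn2 x hx
  refine ⟨s n i m, ⟨i, hin, m, hm, rfl⟩, ?_⟩
  have hle : |s n i m x - d i x| ≤ ∑ i ∈ Finset.range (n + 1), |s n i m x - d i x| :=
    Finset.single_le_sum (f := fun i => |s n i m x - d i x|) (fun _ _ => abs_nonneg _)
      (Finset.mem_range.2 (Nat.lt_succ_of_le hin))
  have hsd : |s n i m x - d i x| ≤ 1 / ((n : ℝ) + 1) := by
    rw [le_div_iff₀ (by positivity)]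
    nlinarith [n.cast_nonneg (α := ℝ)]
  have h1 := hi x hx
  have h2 := abs_sub_le (f x) (d i x) (s n i m x)
  rw [abs_sub_comm (d i x)] at h2
  linarith

theorem FfinSGamma.hasDiagonalBounds (h : FfinSGamma X) {d : ℕ → X → ℝ}
    (hdc : ∀ i, Continuous (d i))
    (hd : ∀ f : X → ℝ, Continuous f → ∃ s : ℕ → ℕ, Tendsto s atTop atTop ∧
      ∀ x, Tendsto (fun k => d (s k) x) atTop (𝓝 (f x))) : HasDiagonalBounds X := by
  intro φ hφc hφ0 hφt
  let t : ℕ → ℕ → X → ℝ := fun n m x => max 0 (min 1 (2 * φ n m x - 1))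
  let ψ : ℕ → ℕ → X → ℝ := fun n m x => (1 - t n m x) * d m x + t n m x
  have htc : ∀ n m, Continuous (t n m) := fun n m =>
    continuous_const.max (continuous_const.min (((hφc n m).const_mul 2).sub continuous_const))
  have hψ : ∀ n, SeqDenseCp (range (ψ n)) := by
    refine fun n => ⟨?_, fun f hf => ?_⟩
    · rintro _ ⟨m, rfl⟩
      exact ((continuous_const.sub (htc n m)).mul (hdc m)).add (htc n m)
    · obtain ⟨s, hs, hsf⟩ := hd f hf
      refine ⟨fun k => ψ n (s k), fun k => ⟨s k, rfl⟩, tendsto_pi_nhds.2 fun x => ?_⟩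
      refine (hsf x).congr' ?_
      filter_upwards [hs.eventually ((hφt n x).eventually (gt_mem_nhds one_half_pos))] with k hk
      have : t n (s k) x = 0 :=
        max_eq_left ((min_le_right _ _).trans (by linarith))
      simp [ψ, this]
  obtain ⟨F, hF, hFK⟩ := h _ hψ
  choose g hg using fun n => exists_index_bound_of_finite (hF n).2 (hF n).1
  refine ⟨g, fun x => ?_⟩
  obtain ⟨N, hN⟩ := hFK 1 one_pos {x} (finite_singleton x)
  filter_upwards [eventually_gt_atTop N] with n hn
  obtain ⟨f, hf, hlt⟩ := hN n hn x rfl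
  obtain ⟨m, hm, rfl⟩ := hg n f hf
  refine ⟨m, hm, by_contra fun hge => ?_⟩
  have : t n m x = 1 := by
    have h1 : (1 : ℝ) ≤ 2 * φ n m x - 1 := by linarith [not_lt.1 hge]
    simp [t, min_eq_left h1]
  simp [ψ, this] at hlt

end SelectionPrinciples

section SequentialSeparability

variable {X : Type u} [TopologicalSpace X]

theorem exists_countable_separating_of_metric (Y : Type*) [MetricSpace Y]
    [TopologicalSpace.SeparableSpace Y] :
    ∃ Φ : Set C(Y, ℝ), Φ.Countable ∧ ∀ C : Set Y, IsClosed C → ∀ x ∉ C,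
      ∃ v ∈ Φ, v x = 0 ∧ ∀ y ∈ C, v y = 1 := by
  obtain ⟨s, hsc, hsd⟩ := TopologicalSpace.exists_countable_dense Y
  let v : Y → ℕ → C(Y, ℝ) := fun z q =>
    ⟨fun y => max 0 (min 1 (q * dist y z - 1)), by fun_prop⟩
  refine ⟨image2 v s univ, hsc.image2 countable_univ v, fun C hC x hx => ?_⟩
  obtain ⟨δ, hδ, hball⟩ := Metric.isOpen_iff.1 hC.isOpen_compl x hx
  obtain ⟨q, hq⟩ := exists_nat_gt (3 / δ)
  have hq0 : (0 : ℝ) < q := (by positivity : 0 < 3 / δ).trans hq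
  have hqδ : 3 < q * δ := by rwa [div_lt_iff₀ hδ] at hq
  obtain ⟨z, hzs, hz⟩ := hsd.exists_dist_lt x (ε := 1 / q) (by positivity)
  have hz' : q * dist x z < 1 := by rwa [lt_div_iff₀ hq0, mul_comm] at hz
  refine ⟨v z q, ⟨z, hzs, q, mem_univ _, rfl⟩, ?_, fun y hy => ?_⟩
  · exact max_eq_left ((min_le_right _ _).trans (by linarith))
  · have hyx : δ ≤ dist y x := not_lt.1 fun h => hball h hy
    have h1 : (1 : ℝ) ≤ q * dist y z - 1 := by
      have h2 : q * δ ≤ q * (dist y z + dist x z) :=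
        mul_le_mul_of_nonneg_left
          (hyx.trans (by simpa [dist_comm] using dist_triangle y z x)) hq0.le
      linarith
    change max 0 (min 1 (q * dist y z - 1)) = 1
    rw [min_eq_left h1]
    exact max_eq_right zero_le_one

theorem VelichkoProperty.exists_countable_separating (hV : VelichkoProperty X) :
    ∃ Φ : Set C(X, ℝ), Φ.Countable ∧ ∀ U : Set X, IsCozeroSet U →
      ∃ Z : ℕ → Set X, U = ⋃ n, Z n ∧ ∀ n, ∀ x ∉ Z n,
        ∃ v ∈ Φ, v x = 0 ∧ ∀ y ∈ Z n, v y = 1 := by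
  obtain ⟨Y, tY, _, _, f, hf, hbij, hU⟩ := hV
  let _ := TopologicalSpace.metrizableSpaceMetric Y
  obtain ⟨Φ, hΦ, hsep⟩ := exists_countable_separating_of_metric Y
  refine ⟨(fun v => v.comp ⟨f, hf⟩) '' Φ, hΦ.image _, fun U hUc => ?_⟩
  obtain ⟨Z, hZ, hUZ⟩ := hU U hUc
  refine ⟨fun n => f ⁻¹' Z n, ?_, fun n x hx => ?_⟩
  · rw [← preimage_iUnion, ← hUZ, preimage_image_eq _ hbij.1]
  · obtain ⟨v, hv, hvx, hvC⟩ := hsep _ (hZ n) (f x) hx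
    exact ⟨_, ⟨v, hv, rfl⟩, hvx, fun y hy => hvC _ hy⟩

theorem countable_algebra_adjoin_rat {A : Type*} [Ring A] [Algebra ℚ A] {s : Set A}
    (hs : s.Countable) : (Algebra.adjoin ℚ s : Set A).Countable := by
  rw [← Cardinal.le_aleph0_iff_set_countable]
  have h := Algebra.lift_cardinalMk_adjoin_le ℚ s
  have hs' : Cardinal.mk s ≤ Cardinal.aleph0 := Cardinal.le_aleph0_iff_set_countable.2 hs
  simpa [hs'] using h

/-- The indicator of a set whose points are separated from it by members of a subalgebra is an
eventually constant limit of members of the subalgebra which equal `1` on that set. -/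
theorem exists_seq_eq_one_eventually_eq_zero {Φ : Set C(X, ℝ)} (hΦ : Φ.Countable) {C : Set X}
    (hC : ∀ x ∉ C, ∃ v ∈ Φ, v x = 0 ∧ ∀ y ∈ C, v y = 1) :
    ∃ θ : ℕ → C(X, ℝ), (∀ m, θ m ∈ Algebra.adjoin ℚ Φ) ∧ (∀ m, ∀ y ∈ C, θ m y = 1) ∧
      ∀ x ∉ C, ∀ᶠ m in atTop, θ m x = 0 := by
  obtain ⟨e, he⟩ := ((hΦ.mono (sep_subset Φ fun v => ∀ y ∈ C, v y = 1)).insert 1).exists_eq_range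
    (insert_nonempty _ _)
  have hmem : ∀ k, e k ∈ insert 1 {v ∈ Φ | ∀ y ∈ C, v y = 1} := fun k => he ▸ mem_range_self k
  refine ⟨fun m => ∏ k ∈ Finset.range m, e k, fun m => ?_, fun m y hy => ?_, fun x hx => ?_⟩
  · refine Subalgebra.prod_mem _ fun k _ => ?_
    rcases hmem k with h | h
    · exact h ▸ one_mem _
    · exact Algebra.subset_adjoin h.1
  · rw [ContinuousMap.prod_apply]
    refine Finset.prod_eq_one fun k _ => ?_
    rcases hmem k with h | h
    · rw [h, ContinuousMap.one_apply]
    · exact h.2 y hy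
  · obtain ⟨v, hv, hvx, hvC⟩ := hC x hx
    have hvr : v ∈ range e := he ▸ mem_insert_of_mem _ ⟨hv, hvC⟩
    obtain ⟨k, rfl⟩ := hvr
    filter_upwards [eventually_gt_atTop k] with m hm
    rw [ContinuousMap.prod_apply]
    exact Finset.prod_eq_zero (Finset.mem_range.2 hm) hvx

/-- A function taking the value `c i` at the points of `C i` outside all earlier `C j` is an
eventually constant limit of members of the subalgebra generated by functions separating points
from the sets `C i`. -/
theorem exists_seq_eventually_eq_first {Φ : Set C(X, ℝ)} (hΦ : Φ.Countable) {C : ℕ → Set X}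
    (hC : ∀ n, ∀ x ∉ C n, ∃ v ∈ Φ, v x = 0 ∧ ∀ y ∈ C n, v y = 1) (c : ℕ → ℚ) :
    ∃ a : ℕ → C(X, ℝ), (∀ m, a m ∈ Algebra.adjoin ℚ Φ) ∧
      ∀ i x, x ∈ C i → (∀ j < i, x ∉ C j) → ∀ᶠ m in atTop, a m x = c i := by
  choose θ hθ hθ1 hθ0 using fun n => exists_seq_eq_one_eventually_eq_zero hΦ (hC n)
  refine ⟨fun m => ∑ i ∈ Finset.range m, c i • (θ i m * ∏ j ∈ Finset.range i, (1 - θ j m)),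
    fun m => ?_, fun i x hx hlt => ?_⟩
  · refine Subalgebra.sum_mem _ fun i _ => Subalgebra.smul_mem _ ?_ _
    exact mul_mem (hθ i m) (Subalgebra.prod_mem _ fun j _ => sub_mem (one_mem _) (hθ j m))
  · have hev : ∀ᶠ m in atTop, ∀ j ∈ Finset.range i, θ j m x = 0 :=
      (Filter.eventually_all_finset _).2 fun j hj => hθ0 j x (hlt j (Finset.mem_range.1 hj))
    filter_upwards [hev, eventually_gt_atTop i] with m hm him
    simp only [ContinuousMap.sum_apply, ContinuousMap.smul_apply, ContinuousMap.mul_apply,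
      ContinuousMap.prod_apply, ContinuousMap.sub_apply, ContinuousMap.one_apply]
    rw [Finset.sum_eq_single i]
    · rw [hθ1 i m x hx, Finset.prod_eq_one fun j hj => by rw [hm j hj, sub_zero], one_mul,
        Rat.smul_def, mul_one]
    · intro k hk hki
      rcases lt_or_gt_of_ne hki with h | h
      · rw [hm k (Finset.mem_range.2 h), zero_mul, smul_zero]
      · rw [Finset.prod_eq_zero (Finset.mem_range.2 h) (by rw [hθ1 i m x hx, sub_self]), mul_zero,
          smul_zero]
    · exact fun h => absurd (Finset.mem_range.2 him) h

theorem exists_seq_eventually_eq_near {Φ : Set C(X, ℝ)} (hΦ : Φ.Countable)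
    (hsep : ∀ U : Set X, IsCozeroSet U → ∃ Z : ℕ → Set X, U = ⋃ n, Z n ∧ ∀ n, ∀ x ∉ Z n,
      ∃ v ∈ Φ, v x = 0 ∧ ∀ y ∈ Z n, v y = 1)
    {f : X → ℝ} (hf : Continuous f) {ε : ℝ} (hε : 0 < ε) :
    ∃ a : ℕ → C(X, ℝ), (∀ m, a m ∈ Algebra.adjoin ℚ Φ) ∧
      ∀ x, ∃ b : ℝ, |f x - b| < ε ∧ ∀ᶠ m in atTop, a m x = b := by
  classical
  choose Z hZ hZsep using fun q : ℚ =>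
    hsep {x | |f x - q| < ε} (isCozeroSet_lt (hf.sub continuous_const).abs ε)
  let e : ℕ ≃ ℚ × ℕ := (Denumerable.eqv (ℚ × ℕ)).symm
  obtain ⟨a, ha, hac⟩ := exists_seq_eventually_eq_first hΦ
    (C := fun i => Z (e i).1 (e i).2) (fun i => hZsep (e i).1 (e i).2) fun i => (e i).1
  refine ⟨a, ha, fun x => ?_⟩
  have hex : ∃ i, x ∈ Z (e i).1 (e i).2 := by
    obtain ⟨q, hq⟩ := Rat.denseRange_cast.exists_dist_lt (f x) hε
    have hx : x ∈ ⋃ n, Z q n := hZ q ▸ hq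
    obtain ⟨n, hn⟩ := mem_iUnion.1 hx
    exact ⟨e.symm (q, n), by simpa using hn⟩
  refine ⟨(e (Nat.find hex)).1, ?_, hac _ x (Nat.find_spec hex) fun j hj => Nat.find_min hex hj⟩
  have hmem : x ∈ ⋃ n, Z (e (Nat.find hex)).1 n := mem_iUnion.2 ⟨_, Nat.find_spec hex⟩
  rw [← hZ] at hmem
  exact hmem

/-- Successive truncations of a sequence `a`: the `n`-th step moves towards `a (n + 1)` by at most
`2 / 2 ^ n`. -/
noncomputable def truncate (a : ℕ → C(X, ℝ)) : ℕ → C(X, ℝ)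
  | 0 => a 0
  | n + 1 => (truncate a n - ContinuousMap.const X (2 / 2 ^ n)) ⊔
      (a (n + 1) ⊓ (truncate a n + ContinuousMap.const X (2 / 2 ^ n)))

theorem abs_truncate_succ_sub_le (a : ℕ → C(X, ℝ)) (n : ℕ) (x : X) :
    |truncate a (n + 1) x - truncate a n x| ≤ 2 / 2 ^ n := by
  have h : (0 : ℝ) < 2 / 2 ^ n := by positivity
  simp only [truncate, ContinuousMap.sup_apply, ContinuousMap.inf_apply, ContinuousMap.sub_apply,
    ContinuousMap.add_apply, ContinuousMap.const_apply]
  rw [abs_le]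
  constructor
  · linarith [le_max_left (truncate a n x - 2 / 2 ^ n)
      (min (a (n + 1) x) (truncate a n x + 2 / 2 ^ n))]
  · rw [sub_le_iff_le_add']
    exact max_le (by linarith) (min_le_right _ _)

theorem abs_truncate_sub_le (a : ℕ → C(X, ℝ)) (n k : ℕ) (x : X) :
    |truncate a (n + k) x - truncate a n x| ≤ 4 / 2 ^ n - 4 / 2 ^ (n + k) := by
  induction k with
  | zero => simp
  | succ k ih =>
    have h := abs_truncate_succ_sub_le a (n + k) x
    have h' := abs_sub_le (truncate a (n + k + 1) x) (truncate a (n + k) x) (truncate a n x)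
    have h2 : (4 : ℝ) / 2 ^ (n + k + 1) = 2 / 2 ^ (n + k) := by
      rw [pow_succ]; field_simp; norm_num
    have h3 : (4 : ℝ) / 2 ^ (n + k) = 2 * (2 / 2 ^ (n + k)) := by ring
    rw [← add_assoc, h2]
    linarith

theorem truncate_apply_eq {a : ℕ → C(X, ℝ)} {n : ℕ} {x : X}
    (h : ∀ j < n, |a (j + 1) x - a j x| ≤ 2 / 2 ^ j) : truncate a n x = a n x := by
  induction n with
  | zero => rfl
  | succ n ih =>
    have ih := ih fun j hj => h j (hj.trans n.lt_succ_self)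
    obtain ⟨h1, h2⟩ := abs_le.1 (h n n.lt_succ_self)
    simp only [truncate, ContinuousMap.sup_apply, ContinuousMap.inf_apply, ContinuousMap.sub_apply,
      ContinuousMap.add_apply, ContinuousMap.const_apply, ih]
    rw [min_eq_left (by linarith), max_eq_right (by linarith)]

theorem countable_truncate {A : Set C(X, ℝ)} (hA : A.Countable) (n : ℕ) :
    {f | ∃ a : ℕ → C(X, ℝ), (∀ n, a n ∈ A) ∧ f = truncate a n}.Countable := by
  induction n with
  | zero =>
    refine hA.mono ?_
    rintro _ ⟨a, ha, rfl⟩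
    exact ha 0
  | succ n ih =>
    refine (ih.image2 hA fun p b => (p - ContinuousMap.const X (2 / 2 ^ n)) ⊔
      (b ⊓ (p + ContinuousMap.const X (2 / 2 ^ n)))).mono ?_
    rintro _ ⟨a, ha, rfl⟩
    exact ⟨truncate a n, ⟨a, ha, rfl⟩, a (n + 1), ha _, rfl⟩

theorem VelichkoProperty.exists_seq_separable (hV : VelichkoProperty X) :
    ∃ d : ℕ → X → ℝ, (∀ i, Continuous (d i)) ∧ ∀ f : X → ℝ, Continuous f →
      ∃ s : ℕ → ℕ, Tendsto s atTop atTop ∧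
        ∀ x, Tendsto (fun k => d (s k) x) atTop (𝓝 (f x)) := by
  obtain ⟨Φ, hΦ, hsep⟩ := hV.exists_countable_separating
  have hD := countable_iUnion fun n => countable_truncate (countable_algebra_adjoin_rat hΦ) n
  obtain ⟨e, he⟩ := hD.exists_eq_range
    ⟨_, mem_iUnion.2 ⟨0, fun _ => 0, fun _ => zero_mem (Algebra.adjoin ℚ Φ), rfl⟩⟩
  refine ⟨fun i => e i.unpair.1, fun i => (e _).continuous, fun f hf => ?_⟩
  choose a haA ha using fun n : ℕ =>
    exists_seq_eventually_eq_near hΦ hsep hf (ε := (1 / 2 ^ n : ℝ)) (by positivity)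
  have hr : ∀ m, ∃ k, e k = truncate (fun n => a n m) m := fun m =>
    he.subset (mem_iUnion.2 ⟨m, fun n => a n m, fun n => haA n m, rfl⟩)
  choose r hr using hr
  refine ⟨fun m => Nat.pair (r m) m, tendsto_atTop_mono (fun m => Nat.right_le_pair _ _)
    tendsto_id, fun x => ?_⟩
  simp only [Nat.unpair_pair, hr]
  choose b hbf hb using fun n => ha n x
  rw [Metric.tendsto_atTop']
  intro ε hε
  obtain ⟨n, hn⟩ := exists_pow_lt_of_lt_one (show 0 < ε / 5 by positivity) one_half_lt_one
  have hev : ∀ᶠ m in atTop, ∀ j ∈ Finset.range (n + 1), a j m x = b j :=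
    (Filter.eventually_all_finset _).2 fun j _ => hb j
  obtain ⟨N, hN⟩ := eventually_atTop.1 (hev.and (eventually_ge_atTop n))
  refine ⟨N, fun m hm => ?_⟩
  obtain ⟨hm1, hm2⟩ := hN m hm.le
  obtain ⟨k, rfl⟩ := Nat.exists_eq_add_of_le hm2
  have hmb : ∀ j ≤ n, a j (n + k) x = b j := fun j hj =>
    hm1 j (Finset.mem_range.2 (Nat.lt_succ_of_le hj))
  have heq : truncate (fun j => a j (n + k)) n x = b n := by
    rw [truncate_apply_eq, hmb n le_rfl]
    intro j hj
    rw [hmb (j + 1) hj, hmb j hj.le]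
    have h1 := hbf j
    have h2 := hbf (j + 1)
    have h3 : (1 : ℝ) / 2 ^ (j + 1) ≤ 1 / 2 ^ j :=
      one_div_le_one_div_of_le (by positivity) (pow_le_pow_right₀ one_le_two j.le_succ)
    have h4 := abs_sub_le (b (j + 1)) (f x) (b j)
    rw [abs_sub_comm (b (j + 1)) (f x)] at h4
    have h5 : (2 : ℝ) / 2 ^ j = 1 / 2 ^ j + 1 / 2 ^ j := by ring
    linarith
  have h1 := abs_truncate_sub_le (fun j => a j (n + k)) n k x
  rw [heq] at h1
  have h2 := hbf n
  have h3 := abs_sub_le (truncate (fun j => a j (n + k)) (n + k) x) (b n) (f x)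
  rw [abs_sub_comm (b n) (f x)] at h3
  have h4 : (0 : ℝ) < 4 / 2 ^ (n + k) := by positivity
  have h5 : (4 : ℝ) / 2 ^ n = 4 * (1 / 2 ^ n) := by ring
  rw [one_div_pow] at hn
  rw [Real.dist_eq]
  linarith

end SequentialSeparability

/-- Theorem 4.5: for a Tychonoff space `X` with the Velichko property, the following
are equivalent: (1) `C_p(X) ⊨ F_fin(𝒮, 𝒮)`; (2) `X ⊨ U_fin(Γ_F, Γ)`;
(3) `C_p(X) ⊨ F_fin(Γ_0, Γ_0)`; (4) `C_p(X) ⊨ F_fin(𝒮, Γ_0)`. -/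
theorem stmt8 (X : Type u) [TopologicalSpace X] [CompletelyRegularSpace X] [T2Space X]
    (hV : VelichkoProperty X) :
    [FfinSS X, UfinGammaFGamma X, FfinGammaGamma X, FfinSGamma X].TFAE := by
  obtain ⟨d, hdc, hd⟩ := hV.exists_seq_separable
  have hdense : ∀ f : X → ℝ, Continuous f → ∀ ε > 0, ∀ K : Set X, K.Finite →
      ∃ i, ∀ x ∈ K, |f x - d i x| < ε := by
    intro f hf ε hε K hK
    obtain ⟨s, -, hs⟩ := hd f hf
    obtain ⟨k, hk⟩ := (hK.eventually_all.2 fun x _ =>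
      (hs x).eventually (Metric.ball_mem_nhds (f x) hε)).exists
    exact ⟨s k, fun x hx => by simpa [Real.dist_eq, abs_sub_comm] using hk x hx⟩
  tfae_have 1 → 4 := FfinSS.ffinSGamma
  tfae_have 4 → 2 := fun h => (h.hasDiagonalBounds hdc hd).ufinGammaFGamma
  tfae_have 2 → 3 := fun h => h.hasDiagonalBounds.ffinGammaGamma
  tfae_have 3 → 1 := fun h => h.hasDiagonalBounds.ffinSS hdc hdense
  tfae_finish
end

section
/- For a separable metrizable space X, the following are equivalent: (1) C_p(X) satisfies F_fin(𝒮, 𝒮); (2) X has the Hurewicz property (U_fin(𝒪, Γ)); (3) C_p(X) satisfies F_fin(Γ_0, Γ_0); (4) C_p(X) satisfies F_fin(𝒮, Γ_0). -/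
open Set Filter Topology

universe u

/-- In a metrizable space every open set is the positivity set of a nonnegative continuous
function. -/
lemma exists_continuous_pos_iff_mem {X : Type u} [TopologicalSpace X]
    [TopologicalSpace.MetrizableSpace X] {U : Set X} (hU : IsOpen U) :
    ∃ φ : X → ℝ, Continuous φ ∧ (∀ x, 0 ≤ φ x) ∧ ∀ x, 0 < φ x ↔ x ∈ U := by
  let _ := TopologicalSpace.metrizableSpaceMetric X
  rcases Uᶜ.eq_empty_or_nonempty with h | h
  · refine ⟨fun _ => 1, continuous_const, fun _ => zero_le_one, fun x => ?_⟩
    simp [compl_empty_iff.mp h]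
  · refine ⟨fun x => Metric.infDist x Uᶜ, Metric.continuous_infDist_pt _,
      fun x => Metric.infDist_nonneg, fun x => ?_⟩
    rw [← hU.isClosed_compl.notMem_iff_infDist_pos h, notMem_compl_iff]

/-- Every open cover of a nonempty separable metrizable space admits a sequence of positive
continuous functions converging pointwise to `0`, each equal to `1` outside the union of a finite
subfamily of the cover. -/
lemma exists_seq_tendsto_zero_of_open_cover {X : Type u} [TopologicalSpace X]
    [TopologicalSpace.MetrizableSpace X] [TopologicalSpace.SeparableSpace X] [Nonempty X]
    {𝒰 : Set (Set X)} (ho : ∀ U ∈ 𝒰, IsOpen U) (hc : ⋃₀ 𝒰 = (univ : Set X)) :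
    ∃ ψ : ℕ → X → ℝ, (∀ k, Continuous (ψ k)) ∧ (∀ k x, 0 < ψ k x) ∧
      (∀ x, Tendsto (fun k => ψ k x) atTop (𝓝 0)) ∧
      ∀ k, ∃ 𝓖 ⊆ 𝒰, 𝓖.Finite ∧ ∀ x ∉ ⋃₀ 𝓖, ψ k x = 1 := by
  let _ := TopologicalSpace.metrizableSpaceMetric X
  have : SecondCountableTopology X := UniformSpace.secondCountable_of_separable X
  obtain ⟨T, hTc, hTU, hT⟩ := TopologicalSpace.isOpen_sUnion_countable 𝒰 ho
  rw [hc] at hT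
  have hTne : T.Nonempty := by
    obtain ⟨x⟩ := ‹Nonempty X›
    obtain ⟨U, hU, -⟩ := mem_sUnion.mp (hT ▸ mem_univ x)
    exact ⟨U, hU⟩
  obtain ⟨V, rfl⟩ := hTc.exists_eq_range hTne
  have hV : ∀ i, V i ∈ 𝒰 := fun i => hTU (mem_range_self i)
  choose φ hφc hφ0 hφ using fun i => exists_continuous_pos_iff_mem (ho _ (hV i))
  have hsum : ∀ (k : ℕ) x, 0 ≤ (k : ℝ) * ∑ i ∈ Finset.range k, φ i x := fun k x =>
    mul_nonneg k.cast_nonneg (Finset.sum_nonneg fun i _ => hφ0 i x)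
  refine ⟨fun k x => (1 + k * ∑ i ∈ Finset.range k, φ i x)⁻¹, fun k => ?_, fun k x => ?_,
    fun x => ?_, fun k => ⟨V '' (Finset.range k : Set ℕ), ?_, ?_, fun x hx => ?_⟩⟩
  · refine Continuous.inv₀ (by fun_prop) fun x => ?_
    linarith [hsum k x]
  · exact inv_pos.mpr (by linarith [hsum k x])
  · obtain ⟨_, ⟨i, rfl⟩, hxi⟩ := mem_sUnion.mp (hT ▸ mem_univ x)
    refine tendsto_inv_atTop_zero.comp (tendsto_atTop_mono' atTop ?_
      (tendsto_natCast_atTop_atTop.atTop_mul_const ((hφ i x).mpr hxi)))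
    filter_upwards [eventually_gt_atTop i] with k hk
    have : φ i x ≤ ∑ j ∈ Finset.range k, φ j x :=
      Finset.single_le_sum (f := fun j => φ j x) (fun j _ => hφ0 j x) (Finset.mem_range.mpr hk)
    have := mul_le_mul_of_nonneg_left this (Nat.cast_nonneg (α := ℝ) k)
    linarith
  · rintro _ ⟨i, -, rfl⟩
    exact hV i
  · exact (Finset.finite_toSet _).image _
  · have : ∑ i ∈ Finset.range k, φ i x = 0 := by
      refine Finset.sum_eq_zero fun i hi => le_antisymm (not_lt.mp fun h => hx ?_) (hφ0 i x)
      exact ⟨V i, mem_image_of_mem V hi, (hφ i x).mp h⟩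
    simp [this]

/-- A selection principle for families of functions whose sets `{|h| < 1}` are covered by finitely
many members of the given covers yields the Hurewicz property. -/
lemma hurewiczProperty_of_selection {X : Type u} [TopologicalSpace X]
    (P : Set (X → ℝ) → Prop)
    (hsel : ∀ S : ℕ → Set (X → ℝ), (∀ n, P (S n)) →
      ∃ F : ℕ → Set (X → ℝ), (∀ n, F n ⊆ S n ∧ (F n).Finite) ∧
        ∀ ε : ℝ, 0 < ε → ∀ K : Set X, K.Finite →
          ∃ n' : ℕ, ∀ n : ℕ, n' < n → ∀ x ∈ K, ∃ h ∈ F n, |h x| < ε)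
    (hP : ∀ 𝒰 : Set (Set X), (∀ U ∈ 𝒰, IsOpen U) → ⋃₀ 𝒰 = (univ : Set X) →
      ∃ S, P S ∧ ∀ h ∈ S, ∃ 𝓖 ⊆ 𝒰, 𝓖.Finite ∧ ∀ x, |h x| < 1 → x ∈ ⋃₀ 𝓖) :
    HurewiczProperty X := by
  intro 𝒰 h𝒰
  choose S hPS hS using fun n => hP (𝒰 n) (h𝒰 n).1 (h𝒰 n).2
  obtain ⟨F, hF, hFsel⟩ := hsel S hPS
  choose! 𝓖 h𝓖U h𝓖fin h𝓖 using hS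
  refine ⟨fun n => ⋃ h ∈ F n, 𝓖 n h, fun n => ⟨?_, ?_⟩, fun x => ?_⟩
  · exact iUnion₂_subset fun h hh => h𝓖U n h ((hF n).1 hh)
  · exact (hF n).2.biUnion fun h hh => h𝓖fin n h ((hF n).1 hh)
  · obtain ⟨N, hN⟩ := hFsel 1 one_pos {x} (finite_singleton x)
    refine (finite_le_nat N).subset fun n hn => ?_
    by_contra hle
    have hlt : N < n := not_le.mp hle
    refine hn ?_
    obtain ⟨h, hh, hx⟩ := hN n hlt x rfl
    obtain ⟨U, hU, hxU⟩ := h𝓖 n h ((hF n).1 hh) x hx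
    exact ⟨U, mem_biUnion hh hU, hxU⟩

lemma hurewiczProperty_of_isEmpty {X : Type u} [TopologicalSpace X] [IsEmpty X] :
    HurewiczProperty X := fun _ _ =>
  ⟨fun _ => ∅, fun _ => ⟨empty_subset _, finite_empty⟩, fun x => isEmptyElim x⟩

lemma gammaZero_range_s9 {X : Type u} [TopologicalSpace X] [Nonempty X] {ψ : ℕ → X → ℝ}
    (hc : ∀ k, Continuous (ψ k)) (hpos : ∀ k x, 0 < ψ k x)
    (hlim : ∀ x, Tendsto (fun k => ψ k x) atTop (𝓝 0)) : GammaZero (range ψ) := by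
  obtain ⟨x⟩ := ‹Nonempty X›
  refine ⟨countable_range ψ, forall_mem_range.mpr hc, ?_, fun hfin => ?_, fun U hU => ?_⟩
  · rintro ⟨k, hk⟩
    exact (hpos k x).ne' (congrFun hk x)
  · have hne : (range ψ).Nonempty := range_nonempty ψ
    obtain ⟨_, ⟨m, rfl⟩, hm⟩ := hfin.exists_minimalFor (fun h => h x) (range ψ) hne
    obtain ⟨k, hk⟩ := ((hlim x).eventually_lt_const (hpos m x)).exists
    exact absurd (hm (mem_range_self k) hk.le) (not_le.mpr hk)
  · have h := (tendsto_pi_nhds.mpr hlim).eventually hU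
    rw [← Nat.cofinite_eq_atTop] at h
    refine (Set.Finite.image ψ h).subset ?_
    rintro _ ⟨⟨k, rfl⟩, hk⟩
    exact ⟨k, hk, rfl⟩

lemma GammaZero.exists_abs_lt {X : Type u} [TopologicalSpace X] {A : Set (X → ℝ)}
    (hA : GammaZero A) (x : X) {ε : ℝ} (hε : 0 < ε) : ∃ h ∈ A, |h x| < ε := by
  obtain ⟨-, -, -, hinf, hconv⟩ := hA
  have hU : {h : X → ℝ | |h x| < ε} ∈ 𝓝 (0 : X → ℝ) :=
    (isOpen_lt (continuous_apply x).abs continuous_const).mem_nhds (by simpa using hε)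
  by_contra! hcon
  exact hinf ((hconv _ hU).subset fun h hh => ⟨hh, not_lt.mpr (hcon h hh)⟩)

lemma SeqDenseCp.exists_abs_sub_lt {X : Type u} [TopologicalSpace X] {D : Set (X → ℝ)}
    (hD : SeqDenseCp D) (x : X) (q : ℝ) {ε : ℝ} (hε : 0 < ε) : ∃ h ∈ D, |q - h x| < ε := by
  obtain ⟨g, hg, hlim⟩ := hD.2 (fun _ => q) continuous_const
  obtain ⟨k, hk⟩ := ((tendsto_pi_nhds.mp hlim x).eventually (Metric.ball_mem_nhds q hε)).exists
  refine ⟨g k, hg k, ?_⟩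
  rwa [abs_sub_comm]

/-- In a Hurewicz space, if the values at each point of the functions in `S n` come arbitrarily
close to the reals in the finite set `Q n`, then finite subsets of the `S n` suffice for all but
finitely many `n`. -/
lemma HurewiczProperty.exists_finite_approx {X : Type u} [TopologicalSpace X]
    (hX : HurewiczProperty X) {S : ℕ → Set (X → ℝ)} (hS : ∀ n, ∀ h ∈ S n, Continuous h)
    (Q : ℕ → Finset ℝ) {ε : ℕ → ℝ} (hSQ : ∀ n x, ∀ q ∈ Q n, ∃ h ∈ S n, |q - h x| < ε n) :
    ∃ F : ℕ → Set (X → ℝ), (∀ n, F n ⊆ S n ∧ (F n).Finite) ∧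
      ∀ x, ∀ᶠ n in atTop, ∀ q ∈ Q n, ∃ h ∈ F n, |q - h x| < ε n := by
  let W : ℕ → Set (X → ℝ) → Set X := fun n G => {x | ∀ q ∈ Q n, ∃ h ∈ G, |q - h x| < ε n}
  obtain ⟨𝓕, h𝓕, hfin⟩ := hX (fun n => W n '' {G | G ⊆ S n ∧ G.Finite}) fun n => by
    refine ⟨?_, eq_univ_of_forall fun x => ?_⟩
    · rintro _ ⟨G, ⟨hGS, -⟩, rfl⟩
      have : W n G = ⋂ q ∈ Q n, ⋃ h ∈ G, {x | |q - h x| < ε n} := by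
        ext x
        simp [W]
      rw [this]
      exact isOpen_biInter_finset fun q _ => isOpen_biUnion fun h hh =>
        isOpen_lt (continuous_const.sub (hS n h (hGS hh))).abs continuous_const
    · choose! g hg hgx using hSQ n x
      refine ⟨_, ⟨g '' (Q n : Set ℝ), ⟨?_, (Q n).finite_toSet.image g⟩, rfl⟩, fun q hq =>
        ⟨g q, mem_image_of_mem g hq, hgx q hq⟩⟩
      rintro _ ⟨q, hq, rfl⟩
      exact hg q hq
  have hrep : ∀ n, ∀ U ∈ 𝓕 n, ∃ G, (G ⊆ S n ∧ G.Finite) ∧ W n G = U := fun n U hU =>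
    (h𝓕 n).1 hU
  choose! G hG hGW using hrep
  refine ⟨fun n => ⋃ U ∈ 𝓕 n, G n U, fun n => ⟨?_, ?_⟩, fun x => ?_⟩
  · exact iUnion₂_subset fun U hU => (hG n U hU).1
  · exact (h𝓕 n).2.biUnion fun U hU => (hG n U hU).2
  · have h := (hfin x).compl_mem_cofinite
    rw [Nat.cofinite_eq_atTop] at h
    filter_upwards [h] with n hn q hq
    obtain ⟨U, hU, hxU⟩ := not_not.mp hn
    rw [← hGW n U hU] at hxU
    obtain ⟨h, hh, hq'⟩ := hxU q hq
    exact ⟨h, mem_biUnion hU hh, hq'⟩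

lemma HurewiczProperty.ffinGammaGamma {X : Type u} [TopologicalSpace X]
    (hX : HurewiczProperty X) : FfinGammaGamma X := by
  intro S hS
  obtain ⟨F, hF, hFx⟩ := hX.exists_finite_approx (fun n => (hS n).2.1) (fun _ => {0})
    (ε := fun n => 1 / ((n : ℝ) + 1)) fun n x q hq => by
      obtain ⟨h, hh, hx⟩ := (hS n).exists_abs_lt x (Nat.one_div_pos_of_nat (n := n))
      refine ⟨h, hh, ?_⟩
      rwa [Finset.mem_singleton.mp hq, zero_sub, abs_neg]
  refine ⟨F, hF, fun ε hε K hK => ?_⟩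
  have hK' : ∀ᶠ n in atTop, ∀ x ∈ K, ∃ h ∈ F n, |h x| < ε := by
    refine (eventually_all_finite hK).mpr fun x _ => ?_
    filter_upwards [hFx x, tendsto_one_div_add_atTop_nhds_zero_nat.eventually_lt_const hε]
      with n hn hnε
    obtain ⟨h, hh, hx⟩ := hn 0 (Finset.mem_singleton_self 0)
    rw [zero_sub, abs_neg] at hx
    exact ⟨h, hh, hx.trans hnε⟩
  obtain ⟨N, hN⟩ := eventually_atTop.mp hK'
  exact ⟨N, fun n hn => hN n hn.le⟩

lemma HurewiczProperty.ffinSS {X : Type u} [TopologicalSpace X]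
    (hX : HurewiczProperty X) : FfinSS X := by
  intro S hS
  let q : ℕ → ℝ := TopologicalSpace.denseSeq ℝ
  obtain ⟨F, hF, hFx⟩ := hX.exists_finite_approx (fun n => (hS n).1)
    (fun n => (Finset.range n).image q) (ε := fun n => 1 / ((n : ℝ) + 1)) fun n x r _ =>
      (hS n).exists_abs_sub_lt x r Nat.one_div_pos_of_nat
  refine ⟨F, hF, fun f _ ε hε K hK => ?_⟩
  have hK' : ∀ᶠ n in atTop, ∀ x ∈ K, ∃ h ∈ F n, |f x - h x| < ε := by
    refine (eventually_all_finite hK).mpr fun x _ => ?_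
    obtain ⟨i, hi⟩ : ∃ i, |f x - q i| < ε / 2 :=
      (TopologicalSpace.denseRange_denseSeq ℝ).exists_dist_lt (f x) (half_pos hε)
    filter_upwards [hFx x, eventually_gt_atTop i,
      tendsto_one_div_add_atTop_nhds_zero_nat.eventually_lt_const (half_pos hε)] with n hn hni hnε
    obtain ⟨h, hh, hx⟩ := hn (q i) (Finset.mem_image_of_mem q (Finset.mem_range.mpr hni))
    refine ⟨h, hh, ?_⟩
    linarith [abs_sub_le (f x) (q i) (h x)]
  obtain ⟨N, hN⟩ := eventually_atTop.mp hK'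
  exact ⟨N, fun n hn => hN n hn.le⟩

lemma FfinSS.ffinSGamma_s9 {X : Type u} [TopologicalSpace X] (hX : FfinSS X) : FfinSGamma X := by
  intro S hS
  obtain ⟨F, hF, hsel⟩ := hX S hS
  exact ⟨F, hF, by simpa using hsel (fun _ => 0) continuous_const⟩

lemma FfinGammaGamma.hurewiczProperty {X : Type u} [TopologicalSpace X]
    [TopologicalSpace.MetrizableSpace X] [TopologicalSpace.SeparableSpace X]
    (hX : FfinGammaGamma X) : HurewiczProperty X := by
  cases isEmpty_or_nonempty X
  · exact hurewiczProperty_of_isEmpty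
  refine hurewiczProperty_of_selection GammaZero hX fun 𝒰 ho hc => ?_
  obtain ⟨ψ, hψc, hψpos, hψlim, hψ⟩ := exists_seq_tendsto_zero_of_open_cover ho hc
  refine ⟨range ψ, gammaZero_range_s9 hψc hψpos hψlim, forall_mem_range.mpr fun k => ?_⟩
  obtain ⟨𝓖, h𝓖, hfin, h⟩ := hψ k
  refine ⟨𝓖, h𝓖, hfin, fun x hx => by_contra fun hx' => ?_⟩
  simp [h x hx'] at hx

lemma FfinSGamma.hurewiczProperty {X : Type u} [TopologicalSpace X]
    [TopologicalSpace.MetrizableSpace X] [TopologicalSpace.SeparableSpace X]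
    (hX : FfinSGamma X) : HurewiczProperty X := by
  cases isEmpty_or_nonempty X
  · exact hurewiczProperty_of_isEmpty
  refine hurewiczProperty_of_selection SeqDenseCp hX fun 𝒰 ho hc => ?_
  obtain ⟨ψ, hψc, -, hψlim, hψ⟩ := exists_seq_tendsto_zero_of_open_cover ho hc
  refine ⟨{h | Continuous h ∧ ∃ 𝓖 ⊆ 𝒰, 𝓖.Finite ∧ ∀ x, |h x| < 1 → x ∈ ⋃₀ 𝓖},
    ⟨fun h hh => hh.1, fun f hf => ?_⟩, fun h hh => hh.2⟩
  refine ⟨fun k x => f x * (1 - ψ k x) + ψ k x, fun k => ⟨?_, ?_⟩,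
    tendsto_pi_nhds.mpr fun x => ?_⟩
  · have := hψc k
    fun_prop
  · obtain ⟨𝓖, h𝓖, hfin, h⟩ := hψ k
    refine ⟨𝓖, h𝓖, hfin, fun x hx => by_contra fun hx' => ?_⟩
    simp [h x hx'] at hx
  · simpa using (((hψlim x).const_sub 1).const_mul (f x)).add (hψlim x)

/-- Theorem 4.6: for a separable metrizable space `X`, the following are equivalent:
(1) `C_p(X) ⊨ F_fin(𝒮, 𝒮)`; (2) `X` has the Hurewicz property `U_fin(𝒪, Γ)`;
(3) `C_p(X) ⊨ F_fin(Γ_0, Γ_0)`; (4) `C_p(X) ⊨ F_fin(𝒮, Γ_0)`. -/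
theorem stmt9 (X : Type u) [TopologicalSpace X] [TopologicalSpace.MetrizableSpace X]
    [TopologicalSpace.SeparableSpace X] :
    [FfinSS X, HurewiczProperty X, FfinGammaGamma X, FfinSGamma X].TFAE := by
  tfae_have 1 → 4 := FfinSS.ffinSGamma_s9
  tfae_have 4 → 2 := FfinSGamma.hurewiczProperty
  tfae_have 2 → 1 := HurewiczProperty.ffinSS
  tfae_have 2 → 3 := HurewiczProperty.ffinGammaGamma
  tfae_have 3 → 2 := FfinGammaGamma.hurewiczProperty
  tfae_finish
end

section
/- For a Tychonoff space X, the space C_p(X) is separable if and only if iw(X) = ℵ_0. -/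
open Set Filter Topology

universe u

/-- A dense family in `C_p(X)` separates the points of a Tychonoff space `X`. -/
lemma DenseCp.exists_apply_ne {X : Type u} [TopologicalSpace X] [CompletelyRegularSpace X]
    [T2Space X] {D : Set (X → ℝ)} (hD : DenseCp D) {x y : X} (hxy : x ≠ y) :
    ∃ f ∈ D, f x ≠ f y := by
  obtain ⟨f, hf, hfx, hfy⟩ :=
    CompletelyRegularSpace.completely_regular x {y} isClosed_singleton (by simpa using hxy)
  have hy : f y = 1 := hfy rfl
  have hU : {g : X → ℝ | g x < g y} ∈ 𝓝 fun z => (f z : ℝ) :=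
    (isOpen_lt (continuous_apply x) (continuous_apply y)).mem_nhds (by simp [hfx, hy])
  obtain ⟨g, hg, hgD⟩ := hD.2 _ (continuous_subtype_val.comp hf) _ hU
  exact ⟨g, hgD, ne_of_lt hg⟩

/-- A finite set of values is attained at prescribed points of a normal Hausdorff space by a
continuous function. -/
lemma Set.Finite.exists_continuousMap_eqOn {Q : Type*} [TopologicalSpace Q] [T4Space Q]
    {K : Set Q} (hK : K.Finite) (v : Q → ℝ) : ∃ g : C(Q, ℝ), EqOn g v K := by
  have := hK.to_subtype
  obtain ⟨g, hg⟩ := ContinuousMap.exists_restrict_eq hK.isClosed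
    (⟨fun z : K => v z, continuous_of_discreteTopology⟩ : C(K, ℝ))
  exact ⟨g, fun z hz => DFunLike.congr_fun hg ⟨z, hz⟩⟩

/-- If `X` admits a continuous injection into a compact Hausdorff second-countable space, then
`C_p(X)` is separable. -/
lemma CpSeparable.of_injective {X : Type u} [TopologicalSpace X] {Q : Type*} [TopologicalSpace Q]
    [CompactSpace Q] [T2Space Q] [SecondCountableTopology Q] {j : X → Q} (hj : Continuous j)
    (hinj : Function.Injective j) : CpSeparable X := by
  obtain ⟨S, hSc, hSd⟩ := TopologicalSpace.exists_countable_dense C(Q, ℝ)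
  refine ⟨(fun φ : C(Q, ℝ) => φ ∘ j) '' S, hSc.image _, ?_, fun f _ U hU => ?_⟩
  · rintro _ ⟨φ, -, rfl⟩
    exact φ.continuous.comp hj
  · rw [nhds_pi, Filter.mem_pi] at hU
    obtain ⟨K, hK, t, ht, hKU⟩ := hU
    obtain ⟨g, hg⟩ := (hK.image j).exists_continuousMap_eqOn (Function.extend j f 0)
    have hev : ∀ᶠ φ : C(Q, ℝ) in 𝓝 g, ∀ x ∈ K, φ (j x) ∈ t x := by
      refine (Filter.eventually_all_finite hK).2 fun x hx => ?_
      refine (continuous_eval_const (j x)).continuousAt.eventually_mem ?_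
      rw [hg (mem_image_of_mem j hx), hinj.extend_apply]
      exact ht x
    obtain ⟨φ, hφS, hφ⟩ := hSd.inter_nhds_nonempty hev
    exact ⟨φ ∘ j, hKU hφ, φ, hφS, rfl⟩

/-- Theorem 2.1 (Noble): for a Tychonoff space `X`, `C_p(X)` is separable iff
`iw(X) = ℵ₀`. -/
theorem stmt10 (X : Type u) [TopologicalSpace X] [CompletelyRegularSpace X] [T2Space X] :
    CpSeparable X ↔ IWCountable X := by
  constructor
  · rintro ⟨D, hDc, hD⟩
    have := hDc.to_subtype
    let e : X → D → ℝ := fun x f => f.1 x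
    have he : Continuous e := continuous_pi fun f => hD.1 f f.2
    have hinj : Function.Injective e := fun x y hxy => by
      by_contra hne
      obtain ⟨f, hf, hfxy⟩ := hD.exists_apply_ne hne
      exact hfxy (congrFun hxy ⟨f, hf⟩)
    let tY : TopologicalSpace X := .induced e inferInstance
    have hemb : @IsEmbedding X (D → ℝ) tY _ e := @IsEmbedding.mk _ _ tY _ _ ⟨rfl⟩ hinj
    exact ⟨X, tY, hemb.secondCountableTopology, hemb.isInducing.completelyRegularSpace,
      hemb.t2Space, id, continuous_induced_rng.2 he, Function.bijective_id⟩
  · rintro ⟨Y, tY, _, _, _, f, hf, hbij⟩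
    let := TopologicalSpace.metrizableSpaceMetric Y
    obtain ⟨F, hF⟩ := Metric.PiNatEmbed.exists_embedding_to_hilbert_cube (X := Y)
    exact .of_injective (hF.continuous.comp hf) (hF.injective.comp hbij.injective)
end

section
/- For a Tychonoff space X, the space C_p(X) is sequentially separable if and only if X has the Velichko property (X ⊨ V). -/
open Set Filter Topology

universe u

/-- Given closed sets `P s` and convex sets `I s ⊆ ℝ`, a sequence of continuous functions that
eventually obeys, at every point `x`, each constraint `x ∈ P s → g m x ∈ I s` compatible with all
the other constraints active at `x`. -/
theorem exists_continuousMap_eventually_mem {K : Type*} [MetricSpace K]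
    {P : ℕ → Set K} {I : ℕ → Set ℝ} (hP : ∀ s, IsClosed (P s)) (hI : ∀ s, Convex ℝ (I s))
    (hne : ∀ s, (I s).Nonempty) :
    ∃ g : ℕ → C(K, ℝ), ∀ x s, x ∈ P s → (∀ t, x ∈ P t → (I s ∩ I t).Nonempty) →
      ∀ᶠ m in atTop, g m x ∈ I s := by
  classical
  let δ : ℕ → ℝ := fun m => 1 / ((m : ℝ) + 1)
  have hδ : ∀ m, 0 < δ m := fun m => Nat.one_div_pos_of_nat
  let Q : ℕ → ℕ → Set K := fun m s =>
    {x | x ∈ P s ∧ ∀ t < s, I s ∩ I t = ∅ → x ∉ Metric.thickening (δ m) (P t)}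
  have hQ : ∀ m s, IsClosed (Q m s) := by
    intro m s
    have : Q m s = P s ∩ ⋂ t, ⋂ (_ : t < s), ⋂ (_ : I s ∩ I t = ∅),
        (Metric.thickening (δ m) (P t))ᶜ := by
      ext x; simp [Q]
    rw [this]
    exact (hP s).inter (isClosed_iInter fun t => isClosed_iInter fun _ => isClosed_iInter fun _ =>
      Metric.isOpen_thickening.isClosed_compl)
  have hQlt : ∀ m x s t, t < s → x ∈ Q m s → x ∈ Q m t → (I s ∩ I t).Nonempty := by
    intro m x s t hts hs ht
    by_contra h
    exact hs.2 t hts (not_nonempty_iff_eq_empty.1 h)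
      (Metric.self_subset_thickening (hδ m) _ ht.1)
  have hQpair : ∀ m x s t, x ∈ Q m s → x ∈ Q m t → (I s ∩ I t).Nonempty := by
    intro m x s t hs ht
    rcases lt_trichotomy s t with h | rfl | h
    · rw [inter_comm]; exact hQlt m x t s h ht hs
    · simpa using hne s
    · exact hQlt m x s t h hs ht
  have key : ∀ m, ∃ g : C(K, ℝ), ∀ x, g x ∈ {c | ∀ s < m, x ∈ Q m s → c ∈ I s} := by
    intro m
    refine exists_continuous_forall_mem_convex_of_local_const (fun x => ?_) (fun x => ?_)
    · have : {c | ∀ s < m, x ∈ Q m s → c ∈ I s} = ⋂ s, ⋂ (_ : s < m), ⋂ (_ : x ∈ Q m s), I s := by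
        ext c; simp
      rw [this]
      exact convex_iInter fun s => convex_iInter fun _ => convex_iInter fun _ => hI s
    · obtain ⟨c, hc⟩ : (⋂ s ∈ (Finset.range m).filter (fun s => x ∈ Q m s), I s).Nonempty := by
        refine Convex.helly_theorem' (𝕜 := ℝ) (fun s _ => hI s) (fun J hJ hcard => ?_)
        rw [Module.finrank_self] at hcard
        have hJQ : ∀ s ∈ J, x ∈ Q m s := fun s hs => (Finset.mem_filter.1 (hJ hs)).2
        rcases J.eq_empty_or_nonempty with rfl | ⟨a, ha⟩
        · simp
        rcases (J.erase a).eq_empty_or_nonempty with h | ⟨b, hb⟩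
        · obtain ⟨c, hc⟩ := hne a
          refine ⟨c, mem_iInter₂.2 fun s hs => ?_⟩
          have : s = a := by
            by_contra hsa
            have : s ∈ J.erase a := Finset.mem_erase.2 ⟨hsa, hs⟩
            simp [h] at this
          exact this ▸ hc
        · obtain ⟨c, hca, hcb⟩ := hQpair m x a b (hJQ a ha) (hJQ b (Finset.mem_of_mem_erase hb))
          refine ⟨c, mem_iInter₂.2 fun s hs => ?_⟩
          by_cases hsa : s = a
          · exact hsa ▸ hca
          have h1 : (J.erase a).card ≤ 1 := by
            rw [Finset.card_erase_of_mem ha]; omega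
          exact Finset.card_le_one.1 h1 s (Finset.mem_erase.2 ⟨hsa, hs⟩) b hb ▸ hcb
      refine ⟨c, ?_⟩
      have : ∀ s ∈ Finset.range m, ∀ᶠ y in 𝓝 x, y ∈ Q m s → x ∈ Q m s := by
        intro s _
        by_cases hx : x ∈ Q m s
        · exact Eventually.of_forall fun _ _ => hx
        · filter_upwards [(hQ m s).isOpen_compl.mem_nhds hx] with y hy h
          exact absurd h hy
      filter_upwards [(Filter.eventually_all_finset _).2 this] with y hy s hs hys
      exact mem_iInter₂.1 hc s
        (Finset.mem_filter.2 ⟨Finset.mem_range.2 hs, hy s (Finset.mem_range.2 hs) hys⟩)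
  choose g hg using key
  refine ⟨g, fun x s hx hcompat => ?_⟩
  have hfar : ∀ t ∈ Finset.range s, ∀ᶠ m in atTop, I s ∩ I t = ∅ →
      x ∉ Metric.thickening (δ m) (P t) := by
    intro t _
    by_cases hxt : x ∈ P t
    · exact Eventually.of_forall fun m h => absurd h (hcompat t hxt).ne_empty
    · have h := Metric.eventually_notMem_thickening_of_infEDist_pos (E := P t)
        (by rwa [(hP t).closure_eq])
      filter_upwards [tendsto_one_div_add_atTop_nhds_zero_nat.eventually h] with m hm _ using hm
  filter_upwards [(Filter.eventually_all_finset _).2 hfar, eventually_gt_atTop s] with m hm hsm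
  exact hg m x s hsm ⟨hx, fun t ht => hm t (Finset.mem_range.2 ht)⟩

/-- Over a separable metrizable space `Y` there is a countable set of continuous functions whose
sequential pointwise limits include every function with `F_σ` open-ray preimages. -/
theorem exists_countable_forall_tendsto_of_isFsigma (Y : Type*) [TopologicalSpace Y]
    [TopologicalSpace.MetrizableSpace Y] [TopologicalSpace.SeparableSpace Y] :
    ∃ D : Set (Y → ℝ), D.Countable ∧ (∀ d ∈ D, Continuous d) ∧ ∀ f : Y → ℝ,
      (∀ q : ℝ, ∃ Z : ℕ → Set Y, (∀ n, IsClosed (Z n)) ∧ {y | f y < q} = ⋃ n, Z n) →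
      (∀ q : ℝ, ∃ Z : ℕ → Set Y, (∀ n, IsClosed (Z n)) ∧ {y | q < f y} = ⋃ n, Z n) →
      ∃ g : ℕ → Y → ℝ, (∀ n, g n ∈ D) ∧ ∀ y, Tendsto (fun n => g n y) atTop (𝓝 (f y)) := by
  let _ : MetricSpace Y := TopologicalSpace.metrizableSpaceMetric Y
  obtain ⟨e, he⟩ := Metric.PiNatEmbed.exists_embedding_to_hilbert_cube (X := Y)
  let _ : MetricSpace (ℕ → unitInterval) := TopologicalSpace.metrizableSpaceMetric _
  obtain ⟨S, hSc, hSd⟩ := TopologicalSpace.exists_countable_dense C(ℕ → unitInterval, ℝ)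
  refine ⟨(fun φ : C(ℕ → unitInterval, ℝ) => φ ∘ e) '' S, hSc.image _, ?_, ?_⟩
  · rintro _ ⟨φ, -, rfl⟩
    exact φ.continuous.comp he.continuous
  intro f hlt hgt
  choose A hAc hA using hlt
  choose B hBc hB using hgt
  obtain ⟨σ, hσ⟩ := exists_surjective_nat (Bool × ℚ × ℕ)
  let Z : Bool × ℚ × ℕ → Set Y := fun s => bif s.1 then A s.2.1 s.2.2 else B s.2.1 s.2.2
  let J : Bool × ℚ × ℕ → Set ℝ := fun s => bif s.1 then Iic (s.2.1 : ℝ) else Ici (s.2.1 : ℝ)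
  have hZc : ∀ s, IsClosed (Z s) := by
    rintro ⟨_ | _, q, n⟩
    exacts [hBc q n, hAc q n]
  have hZJ : ∀ s y, y ∈ Z s → f y ∈ J s := by
    rintro ⟨_ | _, q, n⟩ y hy
    · have : y ∈ {y | (q : ℝ) < f y} := hB q ▸ mem_iUnion.2 ⟨n, hy⟩
      exact (show (q : ℝ) < f y from this).le
    · have : y ∈ {y | f y < (q : ℝ)} := hA q ▸ mem_iUnion.2 ⟨n, hy⟩
      exact (show f y < (q : ℝ) from this).le
  have hmem : ∀ s y, e y ∈ closure (e '' Z s) → y ∈ Z s := by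
    intro s y hy
    have : y ∈ closure (Z s) := by rw [he.closure_eq_preimage_closure_image]; exact hy
    rwa [(hZc s).closure_eq] at this
  obtain ⟨g, hg⟩ := exists_continuousMap_eventually_mem
    (P := fun k => closure (e '' Z (σ k))) (I := fun k => J (σ k)) (fun _ => isClosed_closure)
    (by
      intro k
      rcases σ k with ⟨_ | _, q, n⟩
      exacts [convex_Ici _, convex_Iic _])
    (by
      intro k
      rcases σ k with ⟨_ | _, q, n⟩
      exacts [nonempty_Ici, nonempty_Iic])
  have hgJ : ∀ s y, y ∈ Z s → ∀ᶠ m in atTop, g m (e y) ∈ J s := by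
    intro s y hy
    obtain ⟨k, rfl⟩ := hσ s
    exact hg (e y) k (subset_closure (mem_image_of_mem e hy)) fun t ht =>
      ⟨f y, hZJ _ _ hy, hZJ _ _ (hmem _ _ ht)⟩
  have hglim : ∀ y, Tendsto (fun m => g m (e y)) atTop (𝓝 (f y)) := by
    intro y
    refine tendsto_order.2 ⟨fun a ha => ?_, fun a ha => ?_⟩
    · obtain ⟨q, haq, hqf⟩ := exists_rat_btwn ha
      obtain ⟨n, hn⟩ := mem_iUnion.1 (hB q ▸ hqf : y ∈ ⋃ n, B q n)
      filter_upwards [hgJ (false, q, n) y hn] with m hm using haq.trans_le hm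
    · obtain ⟨q, hfq, hqa⟩ := exists_rat_btwn ha
      obtain ⟨n, hn⟩ := mem_iUnion.1 (hA q ▸ hfq : y ∈ ⋃ n, A q n)
      filter_upwards [hgJ (true, q, n) y hn] with m hm using lt_of_le_of_lt hm hqa
  have happrox : ∀ m : ℕ, ∃ φ ∈ S, dist (g m) φ < 1 / ((m : ℝ) + 1) := fun m =>
    Metric.dense_iff.1 hSd (g m) _ Nat.one_div_pos_of_nat |>.imp fun φ h =>
      ⟨h.2, by simpa [dist_comm] using h.1⟩
  choose φ hφS hφ using happrox
  refine ⟨fun m => φ m ∘ e, fun m => ⟨φ m, hφS m, rfl⟩, fun y => ?_⟩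
  refine (tendsto_iff_of_dist ?_).1 (hglim y)
  exact squeeze_zero (fun _ => dist_nonneg)
    (fun m => (ContinuousMap.dist_apply_le_dist (e y)).trans (hφ m).le)
    tendsto_one_div_add_atTop_nhds_zero_nat

/-- A strict inequality between continuous real-valued functions defines a cozero-set. -/
theorem isCozeroSet_setOf_lt {X : Type u} [TopologicalSpace X] {f g : X → ℝ}
    (hf : Continuous f) (hg : Continuous g) : IsCozeroSet {x | f x < g x} := by
  refine ⟨fun x => max (g x - f x) 0, by fun_prop, ?_⟩
  ext x
  simp

theorem VelichkoProperty.cpSeqSeparable {X : Type u} [TopologicalSpace X]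
    (h : VelichkoProperty X) : CpSeqSeparable X := by
  obtain ⟨Y, _, _, _, p, hpc, hp, hpU⟩ := h
  obtain ⟨D, hDc, hDcont, hD⟩ := exists_countable_forall_tendsto_of_isFsigma Y
  refine ⟨(fun d => d ∘ p) '' D, hDc.image _, ?_, fun f hf => ?_⟩
  · rintro _ ⟨d, hd, rfl⟩
    exact (hDcont d hd).comp hpc
  let E := Equiv.ofBijective p hp
  have hEp : ∀ x, E.symm (p x) = x := E.symm_apply_apply
  have himage : ∀ s : Set ℝ, p '' (f ⁻¹' s) = (f ∘ E.symm) ⁻¹' s := fun s => by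
    rw [preimage_comp]; exact E.image_eq_preimage_symm _
  obtain ⟨g, hgD, hg⟩ := hD (f ∘ E.symm)
    (fun q => by
      obtain ⟨Z, hZ, h⟩ := hpU _ (isCozeroSet_setOf_lt hf continuous_const (g := fun _ => q))
      exact ⟨Z, hZ, (himage (Iio q)).symm.trans h⟩)
    (fun q => by
      obtain ⟨Z, hZ, h⟩ := hpU _ (isCozeroSet_setOf_lt continuous_const hf (f := fun _ => q))
      exact ⟨Z, hZ, (himage (Ioi q)).symm.trans h⟩)
  refine ⟨fun n => g n ∘ p, fun n => ⟨g n, hgD n, rfl⟩, tendsto_pi_nhds.2 fun x => ?_⟩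
  simpa [hEp] using hg (p x)

theorem CpSeqSeparable.velichkoProperty {X : Type u} [TopologicalSpace X]
    [CompletelyRegularSpace X] [T2Space X] (h : CpSeqSeparable X) : VelichkoProperty X := by
  obtain ⟨D, hDc, hDcont, hD⟩ := h
  have : Countable D := hDc.to_subtype
  let Φ : X → D → ℝ := fun x d => d.1 x
  have hΦ : Continuous Φ := continuous_pi fun d => hDcont d.1 d.2
  have hinj : Function.Injective Φ := by
    intro x y hxy
    by_contra hne
    obtain ⟨f, hf, hfx, hfy⟩ := CompletelyRegularSpace.completely_regular x {y}
      isClosed_singleton hne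
    obtain ⟨g, hgD, hg⟩ := hD (fun z => (f z : ℝ)) (continuous_subtype_val.comp hf)
    rw [tendsto_pi_nhds] at hg
    have hgx := hg x
    have : (fun n => g n x) = fun n => g n y := funext fun n => congrFun hxy ⟨g n, hgD n⟩
    rw [this] at hgx
    have := tendsto_nhds_unique hgx (hg y)
    simp [hfx, hfy rfl] at this
  refine ⟨range Φ, inferInstance, inferInstance, inferInstance, rangeFactorization Φ,
    hΦ.subtype_mk _, ⟨fun x y hxy => hinj (congrArg Subtype.val hxy),
      rangeFactorization_surjective⟩, fun U hU => ?_⟩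
  obtain ⟨f, hf, hfU⟩ := hU
  obtain ⟨g, hgD, hg⟩ := hD f hf
  rw [tendsto_pi_nhds] at hg
  let Z : ℕ × ℕ → Set (range Φ) := fun k =>
    {y | ∀ n, k.2 ≤ n → 1 / ((k.1 : ℝ) + 1) ≤ |y.1 ⟨g n, hgD n⟩|}
  have hZ : ∀ k, IsClosed (Z k) := by
    intro k
    simp only [Z, ofPred_forall]
    exact isClosed_iInter fun n => isClosed_iInter fun _ =>
      isClosed_le continuous_const ((continuous_apply _).comp continuous_subtype_val).abs
  obtain ⟨σ, hσ⟩ := exists_surjective_nat (ℕ × ℕ)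
  refine ⟨fun n => Z (σ n), fun n => hZ _, ?_⟩
  rw [hσ.iUnion_comp Z]
  have hmem : ∀ x, x ∈ U ↔ f x ≠ 0 := fun x => by
    have : x ∈ Uᶜ ↔ f x = 0 := by rw [hfU]; rfl
    rw [← not_iff_not]; simpa using this
  ext ⟨_, x, rfl⟩
  have hx : (⟨Φ x, x, rfl⟩ : range Φ) ∈ rangeFactorization Φ '' U ↔ x ∈ U := by
    constructor
    · rintro ⟨z, hz, hzx⟩
      exact hinj (congrArg Subtype.val hzx) ▸ hz
    · exact fun hxU => ⟨x, hxU, rfl⟩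
  rw [hx, hmem, mem_iUnion]
  constructor
  · intro hfx
    obtain ⟨k, hk⟩ := exists_nat_one_div_lt (abs_pos.2 hfx)
    obtain ⟨N, hN⟩ := eventually_atTop.1 ((hg x).abs.eventually_const_lt hk)
    exact ⟨(k, N), fun n hn => (hN n hn).le⟩
  · rintro ⟨⟨k, N⟩, hk⟩ hfx
    have : 1 / ((k : ℝ) + 1) ≤ |f x| :=
      ge_of_tendsto (hg x).abs (eventually_atTop.2 ⟨N, fun n hn => hk n hn⟩)
    rw [hfx, abs_zero] at this
    exact absurd this (not_le.2 Nat.one_div_pos_of_nat)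

/-- Theorem 4.4 (Velichko): for a Tychonoff space `X`, `C_p(X)` is sequentially
separable iff `X` has the Velichko property. -/
theorem stmt11 (X : Type u) [TopologicalSpace X] [CompletelyRegularSpace X] [T2Space X] :
    CpSeqSeparable X ↔ VelichkoProperty X := by
  exact ⟨CpSeqSeparable.velichkoProperty, VelichkoProperty.cpSeqSeparable⟩
end

section
/- If X is a Tychonoff space and C_p(X) satisfies F_fin(𝒮, 𝒟), then X satisfies U_fin(Γ_F, Ω). -/
open Set Filter Topology

universe u

/-- Disjoint zero-sets are completely separated. -/
theorem IsZeroSet.exists_continuous_eq_one_eq_zero {X : Type u} [TopologicalSpace X]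
    {A B : Set X} (hA : IsZeroSet A) (hB : IsZeroSet B) (hAB : Disjoint A B) :
    ∃ φ : X → ℝ, Continuous φ ∧ (∀ x ∈ A, φ x = 1) ∧ ∀ x ∈ B, φ x = 0 := by
  obtain ⟨a, ha, rfl⟩ := hA
  obtain ⟨b, hb, rfl⟩ := hB
  have hne : ∀ x, |a x| + |b x| ≠ 0 := by
    intro x hx
    have hax : a x = 0 := abs_eq_zero.1 (by linarith [abs_nonneg (a x), abs_nonneg (b x)])
    have hbx : b x = 0 := abs_eq_zero.1 (by linarith [abs_nonneg (a x), abs_nonneg (b x)])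
    exact Set.disjoint_left.1 hAB (show x ∈ a ⁻¹' {0} from hax) hbx
  refine ⟨fun x => |b x| / (|a x| + |b x|), hb.abs.div (ha.abs.add hb.abs) hne, ?_, ?_⟩
  · intro x hx
    have hax : a x = 0 := hx
    have := hne x
    simp only [hax, abs_zero, zero_add] at this ⊢
    exact div_self this
  · intro x hx
    have hbx : b x = 0 := hx
    simp [hbx]

/-- If `𝒰` is a `γ_F`-shrinkable cover, the continuous functions that are constantly `1` outside
some member of `𝒰` are sequentially dense in `C_p(X)`. -/
theorem IsGammaFCover.seqDenseCp {X : Type u} [TopologicalSpace X] {𝒰 : Set (Set X)}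
    (h𝒰 : IsGammaFCover 𝒰) :
    SeqDenseCp {g : X → ℝ | Continuous g ∧ ∃ U ∈ 𝒰, ∀ x ∉ U, g x = 1} := by
  obtain ⟨-, hcoz, F, hF, -, hinf, -, hfin⟩ := h𝒰
  refine ⟨fun f hf => hf.1, fun f hf => ?_⟩
  let e := hinf.natEmbedding
  choose U hU hFU using fun k => (e k).2
  have hinj : Function.Injective fun k => F (U k) := fun i j hij =>
    e.injective (Subtype.ext ((hFU i).symm.trans (hij.trans (hFU j))))
  choose φ hφ hφ1 hφ0 using fun k =>
    (hF (U k) (hU k)).1.exists_continuous_eq_one_eq_zero (hcoz (U k) (hU k))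
      (Set.disjoint_compl_right_iff_subset.2 (hF (U k) (hU k)).2)
  refine ⟨fun k x => f x * φ k x + (1 - φ k x), fun k => ⟨?_, U k, hU k, fun x hx => ?_⟩, ?_⟩
  · exact (hf.mul (hφ k)).add (continuous_const.sub (hφ k))
  · simp [hφ0 k x hx]
  · refine tendsto_pi_nhds.2 fun x => tendsto_const_nhds.congr' ?_
    have hx : {k | x ∉ F (U k)}.Finite :=
      ((hfin x).preimage hinj.injOn).subset fun k hk => ⟨mem_image_of_mem F (hU k), hk⟩
    have hev : ∀ᶠ k in atTop, x ∈ F (U k) := by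
      simpa [← Nat.cofinite_eq_atTop, Filter.eventually_cofinite] using hx
    filter_upwards [hev] with k hk
    simp [hφ1 k x hk]

/-- (Theorem 3.3, (1) ⇒ (2)): if `C_p(X)` satisfies `F_fin(𝒮, 𝒟)`, then `X`
satisfies `U_fin(Γ_F, Ω)`. -/
theorem stmt12 (X : Type u) [TopologicalSpace X] [CompletelyRegularSpace X] [T2Space X]
    (h : FfinSD X) : UfinGammaFOmega X := by
  intro 𝒰 h𝒰 hsub
  obtain ⟨F, hF, hdense⟩ := h _ fun n => (h𝒰 n).seqDenseCp
  choose! V hV hV1 using fun n g (hg : g ∈ F n) => ((hF n).1 hg).2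
  have hcover : ∀ K : Set X, K.Finite → ∃ n, K ⊆ ⋃₀ (V n '' F n) := by
    intro K hK
    obtain ⟨n, hn⟩ := hdense (fun _ => 0) continuous_const 1 one_pos K hK
    refine ⟨n, fun x hx => ?_⟩
    obtain ⟨g, hg, hgx⟩ := hn x hx
    refine ⟨V n g, mem_image_of_mem _ hg, ?_⟩
    by_contra hxV
    simp [hV1 n g hg x hxV] at hgx
  have hVsub : ∀ n, V n '' F n ⊆ 𝒰 n := fun n => image_subset_iff.2 (hV n)
  refine ⟨fun n => V n '' F n, fun n => ⟨hVsub n, (hF n).2.image _⟩, ?_, ?_, ?_, ?_⟩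
  · rintro _ ⟨n, rfl⟩
    exact isOpen_sUnion fun W hW => (h𝒰 n).1.1 W (hVsub n hW)
  · rintro ⟨n, hn⟩
    exact hsub n ⟨V n '' F n, hVsub n, (hF n).2.image _, hn⟩
  · refine eq_univ_of_forall fun x => ?_
    obtain ⟨n, hn⟩ := hcover {x} (finite_singleton x)
    exact ⟨_, ⟨n, rfl⟩, hn rfl⟩
  · intro K hK
    obtain ⟨n, hn⟩ := hcover K hK
    exact ⟨_, ⟨n, rfl⟩, hn⟩
end

section
/- If X is a Tychonoff space and C_p(X) satisfies F_fin(𝒮, 𝒮), then X satisfies U_fin(Γ_F, Γ). -/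
open Set Filter Topology

universe u

/-- Two disjoint zero-sets are completely separated. -/
theorem IsZeroSet.exists_continuous_eq_zero_eq_one {X : Type u} [TopologicalSpace X]
    {A B : Set X} (hA : IsZeroSet A) (hB : IsZeroSet B) (hAB : Disjoint A B) :
    ∃ φ : X → ℝ, Continuous φ ∧ (∀ x ∈ A, φ x = 0) ∧ ∀ x ∈ B, φ x = 1 := by
  obtain ⟨a, ha, rfl⟩ := hA
  obtain ⟨b, hb, rfl⟩ := hB
  have hab : ∀ x, a x = 0 → b x ≠ 0 := fun x hax hbx =>
    Set.disjoint_left.mp hAB hax hbx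
  have hpos : ∀ x, a x ^ 2 + b x ^ 2 ≠ 0 := by
    intro x hx
    have h1 : a x = 0 := by nlinarith [sq_nonneg (a x), sq_nonneg (b x)]
    have h2 : b x = 0 := by nlinarith [sq_nonneg (a x), sq_nonneg (b x)]
    exact hab x h1 h2
  refine ⟨fun x => a x ^ 2 / (a x ^ 2 + b x ^ 2), ?_, ?_, ?_⟩
  · exact (ha.pow 2).div ((ha.pow 2).add (hb.pow 2)) hpos
  · intro x hx
    have hx : a x = 0 := hx
    simp [hx]
  · intro x hx
    have hp := hpos x
    have hx : b x = 0 := hx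
    simp only [hx] at hp ⊢
    simp_all

/-- The continuous functions equal to `1` outside some member of `𝒰`. -/
def oneOffMember {X : Type u} [TopologicalSpace X] (𝒰 : Set (Set X)) : Set (X → ℝ) :=
  {g | Continuous g ∧ ∃ U ∈ 𝒰, ∀ x ∉ U, g x = 1}

theorem IsGammaFCover.seqDenseCp_oneOffMember {X : Type u} [TopologicalSpace X]
    {𝒰 : Set (Set X)} (h𝒰 : IsGammaFCover 𝒰) : SeqDenseCp (oneOffMember 𝒰) := by
  obtain ⟨-, hcoz, F, hF, -, hinf, -, hfin⟩ := h𝒰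
  refine ⟨fun f hf => hf.1, fun f hf => ?_⟩
  let V : ℕ ↪ F '' 𝒰 := hinf.natEmbedding
  choose U hU hFU using fun n => (V n).2
  have hsep : ∀ n, ∃ φ : X → ℝ, Continuous φ ∧ (∀ x ∈ F (U n), φ x = 0) ∧
      ∀ x ∈ (U n)ᶜ, φ x = 1 := fun n =>
    (hF _ (hU n)).1.exists_continuous_eq_zero_eq_one (hcoz _ (hU n))
      (Set.disjoint_compl_right_iff_subset.mpr (hF _ (hU n)).2)
  choose φ hφ hφ0 hφ1 using hsep
  refine ⟨fun n x => f x + (1 - f x) * φ n x, fun n => ⟨?_, U n, hU n, fun x hx => ?_⟩, ?_⟩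
  · exact hf.add ((continuous_const.sub hf).mul (hφ n))
  · simp [hφ1 n x hx]
  · refine tendsto_pi_nhds.mpr fun x => tendsto_const_nhds.congr' ?_
    have hx : {n | x ∉ F (U n)}.Finite := by
      refine ((hfin x).preimage (Subtype.val_injective.comp V.injective).injOn).subset ?_
      intro n hn
      refine ⟨(V n).2, ?_⟩
      simpa [← hFU n] using hn
    filter_upwards [Nat.cofinite_eq_atTop ▸ hx.compl_mem_cofinite] with n hn
    simp [hφ0 n x (not_not.mp hn)]

/-- A sequence of proper subsets, each point lying in all but finitely many terms, has
range a γ-cover. -/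
theorem isGammaCoverSets_range {X : Type u} {W : ℕ → Set X} (hne : ∀ n, W n ≠ univ)
    (hW : ∀ x, ∀ᶠ n in atTop, x ∈ W n) : IsGammaCoverSets (Set.range W) := by
  refine ⟨?_, ?_, ?_, fun x => ?_⟩
  · rintro ⟨n, hn⟩
    exact hne n hn
  · intro hfin
    have : Finite (Set.range W) := hfin
    obtain ⟨⟨V, m, rfl⟩, hV⟩ := Finite.exists_infinite_fiber (Set.rangeFactorization W)
    obtain ⟨x, hx⟩ := (Set.ne_univ_iff_exists_notMem _).mp (hne m)
    obtain ⟨n, hn, hxn⟩ := ((Nat.frequently_atTop_iff_infinite.mpr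
      (Set.infinite_coe_iff.mp hV)).and_eventually (hW x)).exists
    have hnm : W n = W m := congrArg Subtype.val hn
    exact hx (hnm ▸ hxn)
  · refine Set.eq_univ_of_forall fun x => ?_
    obtain ⟨n, hn⟩ := (hW x).exists
    exact ⟨W n, ⟨n, rfl⟩, hn⟩
  · have hx : {n | x ∉ W n}.Finite := by
      have := hW x
      rwa [← Nat.cofinite_eq_atTop, Filter.eventually_cofinite] at this
    refine (hx.image W).subset ?_
    rintro _ ⟨⟨n, rfl⟩, hn⟩
    exact ⟨n, hn, rfl⟩

/-- (Theorem 4.5, (1) ⇒ (2)): if `C_p(X)` satisfies `F_fin(𝒮, 𝒮)`, then `X`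
satisfies `U_fin(Γ_F, Γ)`. -/
theorem stmt13 (X : Type u) [TopologicalSpace X] [CompletelyRegularSpace X] [T2Space X]
    (h : FfinSS X) : UfinGammaFGamma X := by
  intro 𝒰 h𝒰 hsub
  obtain ⟨F, hF, happrox⟩ := h (fun n => oneOffMember (𝒰 n))
    fun n => (h𝒰 n).seqDenseCp_oneOffMember
  choose U hU hU1 using fun n (g : F n) => ((hF n).1 g.2).2
  have hrange : ∀ n, Set.range (U n) ⊆ 𝒰 n ∧ (Set.range (U n)).Finite := fun n =>
    have : Finite (F n) := (hF n).2
    ⟨Set.range_subset_iff.mpr (hU n), Set.finite_range _⟩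
  refine ⟨fun n => Set.range (U n), hrange, ?_, isGammaCoverSets_range ?_ fun x => ?_⟩
  · rintro _ ⟨n, rfl⟩
    exact isOpen_sUnion fun V hV => (h𝒰 n).1.1 V ((hrange n).1 hV)
  · exact fun n hn => hsub n ⟨_, (hrange n).1, (hrange n).2, hn⟩
  · obtain ⟨n', hn'⟩ := happrox 0 continuous_const 1 one_pos {x} (Set.finite_singleton x)
    filter_upwards [Filter.eventually_gt_atTop n'] with n hn
    obtain ⟨g, hg, hgx⟩ := hn' n hn x rfl
    refine ⟨U n ⟨g, hg⟩, ⟨_, rfl⟩, ?_⟩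
    by_contra hx
    have hg1 : g x = 1 := hU1 n ⟨g, hg⟩ x hx
    simp [hg1] at hgx
end

section
/- If X is a Tychonoff space such that C_p(X) is sequentially separable and C_p(X) satisfies F_fin(𝒮, Γ_0), then C_p(X) satisfies F_fin(𝒮, 𝒮). -/
open Set Filter Topology

universe u

/-- Translating a sequentially dense set by a continuous function keeps it sequentially dense. -/
theorem SeqDenseCp.image_sub {X : Type u} [TopologicalSpace X] {S : Set (X → ℝ)}
    (hS : SeqDenseCp S) {d : X → ℝ} (hd : Continuous d) :
    SeqDenseCp ((fun g => g - d) '' S) := by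
  refine ⟨?_, fun f hf => ?_⟩
  · rintro _ ⟨g, hg, rfl⟩
    exact (hS.1 g hg).sub hd
  · obtain ⟨g, hgS, hg⟩ := hS.2 (f + d) (hf.add hd)
    refine ⟨fun n => g n - d, fun n => ⟨g n, hgS n, rfl⟩, ?_⟩
    simpa using hg.sub_const d

/-- Under `F_fin(𝒮, Γ_0)`, finite selections can be made to approximate any prescribed
continuous function. -/
theorem FfinSGamma.exists_approx {X : Type u} [TopologicalSpace X] (h : FfinSGamma X)
    {S : ℕ → Set (X → ℝ)} (hS : ∀ n, SeqDenseCp (S n)) {d : X → ℝ} (hd : Continuous d) :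
    ∃ F : ℕ → Set (X → ℝ), (∀ n, F n ⊆ S n ∧ (F n).Finite) ∧
      ∀ ε : ℝ, 0 < ε → ∀ K : Set X, K.Finite →
        ∃ n' : ℕ, ∀ n : ℕ, n' < n → ∀ x ∈ K, ∃ g ∈ F n, |d x - g x| < ε := by
  obtain ⟨G, hG, hlim⟩ := h _ fun n => (hS n).image_sub hd
  refine ⟨fun n => (fun g => g + d) '' G n, fun n => ⟨?_, (hG n).2.image _⟩, ?_⟩
  · rintro _ ⟨g, hg, rfl⟩
    obtain ⟨s, hs, rfl⟩ := (hG n).1 hg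
    simpa using hs
  · intro ε hε K hK
    obtain ⟨n', hn'⟩ := hlim ε hε K hK
    refine ⟨n', fun n hn x hx => ?_⟩
    obtain ⟨g, hg, hgx⟩ := hn' n hn x hx
    exact ⟨g + d, ⟨g, hg, rfl⟩, by simpa using hgx⟩

/-- (Theorem 4.5, (4) ⇒ (1)): if `C_p(X)` is sequentially separable and satisfies
`F_fin(𝒮, Γ_0)`, then `C_p(X)` satisfies `F_fin(𝒮, 𝒮)`. -/
theorem stmt14 (X : Type u) [TopologicalSpace X] [CompletelyRegularSpace X] [T2Space X]
    (hsep : CpSeqSeparable X) (h : FfinSGamma X) : FfinSS X := by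
  intro S hS
  obtain ⟨D, hDc, hD⟩ := hsep
  have hDne : D.Nonempty := by
    obtain ⟨g, hg, -⟩ := hD.2 0 continuous_const
    exact ⟨g 0, hg 0⟩
  obtain ⟨d, rfl⟩ := hDc.exists_eq_range hDne
  choose F hF happrox using fun k => h.exists_approx hS (hD.1 (d k) (mem_range_self k))
  refine ⟨fun n => ⋃ k ∈ Iic n, F k n,
    fun n => ⟨iUnion₂_subset fun k _ => (hF k n).1,
      (finite_Iic n).biUnion fun k _ => (hF k n).2⟩, fun f hf ε hε K hK => ?_⟩
  obtain ⟨g, hgD, hg⟩ := hD.2 f hf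
  have hclose : ∀ᶠ i in atTop, ∀ x ∈ K, |g i x - f x| < ε / 2 := by
    refine (eventually_all_finite hK).2 fun x _ => ?_
    exact (Metric.tendsto_nhds.1 (tendsto_pi_nhds.1 hg x)) (ε / 2) (half_pos hε)
  obtain ⟨i, hi⟩ := hclose.exists
  obtain ⟨k, hk⟩ := hgD i
  obtain ⟨n', hn'⟩ := happrox k (ε / 2) (half_pos hε) K hK
  refine ⟨max n' k, fun n hn x hx => ?_⟩
  obtain ⟨s, hs, hsx⟩ := hn' n ((le_max_left _ _).trans_lt hn) x hx
  refine ⟨s, mem_biUnion (mem_Iic.2 ((le_max_right _ _).trans hn.le)) hs, ?_⟩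
  have hfx := hi x hx
  rw [← hk, abs_sub_comm] at hfx
  linarith [abs_sub_le (f x) (d k x) (s x)]
end
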